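/- arXiv:1704.03378 — 3 statements merged into one kernel-verified Lean document; each statement's English description precedes it below -/
import Mathlib

section
/- Let f be a smooth compactly supported function on ℝ³ with polar form F, let p ∈ C¹([0,π/2]) and set ρ(r,φ) = p(arcsin(r sin φ)) for r ∈ [0,1], φ ∈ [0,π], and let w : [0,1]×[0,π] → ℝ be continuous. Then for every natural number l, every integer m with |m| ≤ l, and every r ∈ [0,1], the (l,m)-th spherical harmonic coefficient of the generalized spindle transform, namely 𝒮_{w,p}f_{lm}(r) = ∫₀^π ∫₀^{2π} 𝒮_{w,p}f(r,α,β) · conj(Y_l^m(α,β)) · sin β dα dβ, satisfies 𝒮_{w,p}f_{lm}(r) = 2π ∫₀^π w(r,φ) ρ(r,φ) sin φ √(ρ(r,φ)² + (∂ρ/∂φ(r,φ))²) F_{lm}(ρ(r,φ)) P_l(cos φ) dφ. -/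
noncomputable section
open Real MeasureTheory Set Filter

abbrev R3 := EuclideanSpace ℝ (Fin 3)

/-- The unit vector with spherical angles `θ` (azimuth) and `φ` (colatitude). -/
def sphVec (θ φ : ℝ) : R3 :=
  (WithLp.equiv 2 (Fin 3 → ℝ)).symm ![sin φ * cos θ, sin φ * sin θ, cos φ]

/-- Rotation about the `x₃` axis by angle `α`. -/
def rotZ (α : ℝ) (x : R3) : R3 :=
  (WithLp.equiv 2 (Fin 3 → ℝ)).symm
    ![cos α * x 0 - sin α * x 1, sin α * x 0 + cos α * x 1, x 2]

/-- Rotation about the `x₂` axis by angle `β`. -/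
def rotY (β : ℝ) (x : R3) : R3 :=
  (WithLp.equiv 2 (Fin 3 → ℝ)).symm
    ![cos β * x 0 + sin β * x 2, x 1, -sin β * x 0 + cos β * x 2]

/-- `h = U(α)V(β)`. -/
def rotUV (α β : ℝ) (x : R3) : R3 := rotZ α (rotY β x)

/-- Legendre polynomial of degree `l`. -/
def legendreP (l : ℕ) (x : ℝ) : ℝ :=
  (1 / 2 ^ l) * ∑ k ∈ Finset.range (l + 1),
    (l.choose k : ℝ) ^ 2 * (x - 1) ^ (l - k) * (x + 1) ^ k

/-- Associated Legendre function for `0 ≤ m ≤ l`. -/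
def assocP (l m : ℕ) (x : ℝ) : ℝ :=
  (-1 : ℝ) ^ m * (1 - x ^ 2) ^ ((m : ℝ) / 2) * iteratedDeriv m (legendreP l) x

/-- Associated Legendre function for integer `m`, `|m| ≤ l`. -/
def assocPZ (l : ℕ) (m : ℤ) (x : ℝ) : ℝ :=
  if 0 ≤ m then assocP l m.toNat x
  else (-1 : ℝ) ^ m.natAbs *
    (((l - m.natAbs).factorial : ℝ) / ((l + m.natAbs).factorial : ℝ)) * assocP l m.natAbs x

/-- Spherical harmonic `Y_l^m(θ,φ)`. -/
def sphHarm (l : ℕ) (m : ℤ) (θ φ : ℝ) : ℂ :=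
  Complex.ofReal ((-1 : ℝ) ^ m *
    Real.sqrt ((2 * (l : ℝ) + 1) * (((l : ℤ) - m).toNat.factorial : ℝ) /
      (4 * π * (((l : ℤ) + m).toNat.factorial : ℝ))) *
    assocPZ l m (cos φ)) * Complex.exp (Complex.I * m * θ)

/-- Harmonic coefficient `F_{lm}(ρ)` of the polar form `F` of `f`. -/
def harmCoef (f : R3 → ℝ) (l : ℕ) (m : ℤ) (ρ : ℝ) : ℂ :=
  ∫ φ in (0:ℝ)..π, ∫ θ in (0:ℝ)..(2 * π),
    (f (ρ • sphVec θ φ) : ℂ) * (starRingEnd ℂ) (sphHarm l m θ φ) * (sin φ : ℂ)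

/-- The symmetric curve `ρ(r,φ) = p(arcsin (r sin φ))`. -/
def curveρ (p : ℝ → ℝ) (r φ : ℝ) : ℝ := p (arcsin (r * sin φ))

/-- The generalized spindle transform `𝒮_{w,p} f`. -/
def genSpindle (w : ℝ → ℝ → ℝ) (p : ℝ → ℝ) (f : R3 → ℝ) (r α β : ℝ) : ℝ :=
  ∫ θ in (0:ℝ)..(2 * π), ∫ φ in (0:ℝ)..π,
    w r φ * curveρ p r φ * sin φ *
      Real.sqrt ((curveρ p r φ) ^ 2 + (deriv (curveρ p r) φ) ^ 2) *
      f (curveρ p r φ • rotUV α β (sphVec θ φ))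

/-- The `(l,m)` spherical harmonic coefficient of `𝒮_{w,p} f` in `(α,β)`. -/
def genSpindleCoef (w : ℝ → ℝ → ℝ) (p : ℝ → ℝ) (f : R3 → ℝ) (l : ℕ) (m : ℤ) (r : ℝ) : ℂ :=
  ∫ β in (0:ℝ)..π, ∫ α in (0:ℝ)..(2 * π),
    (genSpindle w p f r α β : ℂ) * (starRingEnd ℂ) (sphHarm l m α β) * (sin β : ℂ)

open scoped ComplexConjugate

/-! ### Trinomial coefficients and Legendre polynomials -/

/-- The coefficient of `z ^ m` in `(X + A z + B / z) ^ l`, divided by `A ^ m`, as a function of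
`P = A B` and `X`. -/
def reducedTrinomial {R : Type*} [CommRing R] (P X : R) : ℕ → ℕ → R
  | 0, 0 => 1
  | 0, _ + 1 => 0
  | l + 1, 0 => X * reducedTrinomial P X l 0 + 2 * P * reducedTrinomial P X l 1
  | l + 1, m + 1 => X * reducedTrinomial P X l (m + 1) + reducedTrinomial P X l m +
      P * reducedTrinomial P X l (m + 2)

theorem map_reducedTrinomial {R S : Type*} [CommRing R] [CommRing S] (g : R →+* S) (P X : R)
    (l : ℕ) : ∀ m : ℕ, g (reducedTrinomial P X l m) = reducedTrinomial (g P) (g X) l m := by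
  induction l with
  | zero => rintro (_ | m) <;> simp [reducedTrinomial]
  | succ l ih => rintro (_ | m) <;> simp [reducedTrinomial, ih, map_ofNat]

theorem pow_mul_reducedTrinomial {R : Type*} [CommRing R] (P X c : R) (l : ℕ) : ∀ m : ℕ,
    c ^ m * reducedTrinomial (c ^ 2 * P) (c * X) l m = c ^ l * reducedTrinomial P X l m := by
  induction l with
  | zero => rintro (_ | m) <;> simp [reducedTrinomial]
  | succ l ih =>
    rintro (_ | m)
    · simp only [reducedTrinomial]
      linear_combination c * X * ih 0 + 2 * c * P * ih 1
    · simp only [reducedTrinomial]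
      linear_combination c * X * ih (m + 1) + c * ih m + c * P * ih (m + 2)

theorem reducedTrinomial_three_term (P X : ℝ) (l : ℕ) : ∀ m : ℕ,
    ((l : ℝ) - m) * reducedTrinomial P X l m =
      (m + 1) * X * reducedTrinomial P X l (m + 1) +
        (l + m + 2) * P * reducedTrinomial P X l (m + 2) := by
  induction l with
  | zero => rintro (_ | m) <;> simp [reducedTrinomial]
  | succ l ih =>
    rintro (_ | m)
    · have h0 := ih 0
      have h1 := ih 1
      simp only [reducedTrinomial]
      push_cast at h0 h1 ⊢
      linear_combination X * h0 + P * h1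
    · have h0 := ih m
      have h1 := ih (m + 1)
      have h2 := ih (m + 2)
      simp only [reducedTrinomial]
      push_cast at h0 h1 h2 ⊢
      linear_combination h0 + X * h1 + P * h2

theorem hasDerivAt_reducedTrinomial (l : ℕ) : ∀ (m : ℕ) (x : ℝ),
    HasDerivAt (fun y => reducedTrinomial ((y ^ 2 - 1) / 4) y l m)
      ((l + m + 1) / 2 * reducedTrinomial ((x ^ 2 - 1) / 4) x l (m + 1)) x := by
  induction l with
  | zero =>
    rintro (_ | m) x <;> simp only [reducedTrinomial, mul_zero] <;> exact hasDerivAt_const _ _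
  | succ l ih =>
    have hP (x : ℝ) : HasDerivAt (fun y : ℝ => (y ^ 2 - 1) / 4) (x / 2) x := by
      have := (((hasDerivAt_id x).pow 2).sub_const 1).div_const 4
      refine this.congr_deriv ?_
      simp; ring
    rintro (_ | m) x
    · have E := reducedTrinomial_three_term ((x ^ 2 - 1) / 4) x l 0
      simp only [reducedTrinomial]
      refine (((hasDerivAt_id x).mul (ih 0 x)).add
        (((hP x).const_mul 2).mul (ih 1 x))).congr_deriv ?_
      simp only [id]
      push_cast at E ⊢
      linear_combination (-1 / 2) * E
    · simp only [reducedTrinomial]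
      refine ((((hasDerivAt_id x).mul (ih (m + 1) x)).add (ih m x)).add
        ((hP x).mul (ih (m + 2) x))).congr_deriv ?_
      simp only [id]
      push_cast
      ring

theorem integral_exp_int_mul (n : ℤ) :
    ∫ θ in (0 : ℝ)..(2 * π), Complex.exp (Complex.I * n * θ) =
      if n = 0 then ((2 * π : ℝ) : ℂ) else 0 := by
  split_ifs with h
  · simp [h]
  · have hn : Complex.I * n ≠ 0 := mul_ne_zero Complex.I_ne_zero (by exact_mod_cast h)
    rw [integral_exp_mul_complex hn]
    have : Complex.exp (Complex.I * n * ((2 * π : ℝ) : ℂ)) = 1 := by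
      rw [← Complex.exp_int_mul_two_pi_mul_I n]
      congr 1; push_cast; ring
    rw [this]; simp

/-- The `n`-th Fourier coefficient of the `l`-th power of a trigonometric trinomial. -/
def trinomialFourier (X A B : ℂ) (l : ℕ) (n : ℤ) : ℂ :=
  ∫ θ in (0 : ℝ)..(2 * π), Complex.exp (-(Complex.I * n * θ)) *
    (X + A * Complex.exp (Complex.I * θ) + B * Complex.exp (-(Complex.I * θ))) ^ l

theorem trinomialFourier_zero (X A B : ℂ) (n : ℤ) :
    trinomialFourier X A B 0 n = if n = 0 then ((2 * π : ℝ) : ℂ) else 0 := by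
  have := integral_exp_int_mul (-n)
  simp only [Int.cast_neg, neg_eq_zero] at this
  rw [← this, trinomialFourier]
  congr 1; ext θ; simp

theorem trinomialFourier_succ (X A B : ℂ) (l : ℕ) (n : ℤ) :
    trinomialFourier X A B (l + 1) n = X * trinomialFourier X A B l n +
      A * trinomialFourier X A B l (n - 1) + B * trinomialFourier X A B l (n + 1) := by
  simp only [trinomialFourier, ← intervalIntegral.integral_const_mul]
  rw [← intervalIntegral.integral_add, ← intervalIntegral.integral_add]
  · congr 1; ext θ
    have h1 : Complex.exp (-(Complex.I * ((n - 1 : ℤ) : ℂ) * θ)) =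
        Complex.exp (-(Complex.I * n * θ)) * Complex.exp (Complex.I * θ) := by
      rw [← Complex.exp_add]; congr 1; push_cast; ring
    have h2 : Complex.exp (-(Complex.I * ((n + 1 : ℤ) : ℂ) * θ)) =
        Complex.exp (-(Complex.I * n * θ)) * Complex.exp (-(Complex.I * θ)) := by
      rw [← Complex.exp_add]; congr 1; push_cast; ring
    rw [h1, h2]; ring
  all_goals exact Continuous.intervalIntegrable (by fun_prop) _ _

theorem trinomialFourier_eq {P X A B : ℂ} (h : A * B = P) (l : ℕ) : ∀ m : ℕ,
    trinomialFourier X A B l m = 2 * π * A ^ m * reducedTrinomial P X l m ∧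
    trinomialFourier X A B l (-m) = 2 * π * B ^ m * reducedTrinomial P X l m := by
  induction l with
  | zero =>
    rintro (_ | m)
    · simp [trinomialFourier_zero, reducedTrinomial]
    · simp only [trinomialFourier_zero, reducedTrinomial]
      constructor <;> rw [if_neg (by push_cast; omega)] <;> simp
  | succ l ih =>
    rintro (_ | m)
    · have h0 := (ih 0).1
      have h1 := ih 1
      simp only [trinomialFourier_succ, reducedTrinomial]
      simp only [Nat.cast_zero, Nat.cast_one, neg_zero, zero_sub, zero_add] at h0 h1 ⊢
      rw [h0, h1.1, h1.2]
      rw [← h]; constructor <;> ring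
    · have h0 := ih m
      have h1 := ih (m + 1)
      have h2 := ih (m + 2)
      simp only [trinomialFourier_succ, reducedTrinomial]
      have e1 : ((m + 1 : ℕ) : ℤ) - 1 = m := by push_cast; ring
      have e2 : ((m + 1 : ℕ) : ℤ) + 1 = (m + 2 : ℕ) := by push_cast; ring
      have e3 : -((m + 1 : ℕ) : ℤ) - 1 = -((m + 2 : ℕ) : ℤ) := by push_cast; ring
      have e4 : -((m + 1 : ℕ) : ℤ) + 1 = -(m : ℤ) := by push_cast; ring
      rw [e1, e2, e3, e4, h0.1, h0.2, h1.1, h1.2, h2.1, h2.2]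
      rw [← h]; constructor <;> ring

theorem trinomialFourier_legendre (x : ℝ) (l : ℕ) :
    trinomialFourier x ((x + 1) / 2) ((x - 1) / 2) l 0 = 2 * π * legendreP l x := by
  have hpt (θ : ℝ) : Complex.exp (-(Complex.I * ((0 : ℤ) : ℂ) * θ)) *
      ((x : ℂ) + (x + 1) / 2 * Complex.exp (Complex.I * θ) +
        (x - 1) / 2 * Complex.exp (-(Complex.I * θ))) ^ l =
      ∑ i ∈ Finset.range (l + 1), ∑ j ∈ Finset.range (l + 1),
        ((l.choose i : ℂ) * l.choose j * ((x + 1) / 2) ^ j * ((x - 1) / 2) ^ (l - j)) *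
          Complex.exp (Complex.I * ((j - i : ℤ) : ℂ) * θ) := by
    have hE : Complex.exp (Complex.I * θ) * Complex.exp (-(Complex.I * θ)) = 1 := by
      rw [← Complex.exp_add]; simp
    have hfac : (x : ℂ) + (x + 1) / 2 * Complex.exp (Complex.I * θ) +
        (x - 1) / 2 * Complex.exp (-(Complex.I * θ)) = (1 + Complex.exp (Complex.I * θ)) *
          ((x + 1) / 2 + (x - 1) / 2 * Complex.exp (-(Complex.I * θ))) := by
      linear_combination -(x - 1) / 2 * hE
    rw [hfac, mul_pow, add_pow, add_pow, Finset.sum_mul_sum]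
    simp only [Int.cast_zero, mul_zero, zero_mul, neg_zero, Complex.exp_zero, one_mul, one_pow]
    refine Finset.sum_congr rfl fun i hi => Finset.sum_congr rfl fun j hj => ?_
    have hi' : i ≤ l := by simpa [Nat.lt_succ_iff] using hi
    have hj' : j ≤ l := by simpa [Nat.lt_succ_iff] using hj
    have : Complex.exp (Complex.I * ((j - i : ℤ) : ℂ) * θ) =
        Complex.exp (Complex.I * θ) ^ (l - i) * Complex.exp (-(Complex.I * θ)) ^ (l - j) := by
      rw [← Complex.exp_nat_mul, ← Complex.exp_nat_mul, ← Complex.exp_add]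
      congr 1
      push_cast [hi', hj']
      ring
    rw [this, mul_pow]; ring
  rw [trinomialFourier]
  simp only [hpt]
  rw [intervalIntegral.integral_finsetSum]
  swap
  · exact fun i _ => Continuous.intervalIntegrable (by fun_prop) _ _
  have hin (i : ℕ) : (∫ θ in (0 : ℝ)..(2 * π), ∑ j ∈ Finset.range (l + 1),
        ((l.choose i : ℂ) * l.choose j * ((x + 1) / 2) ^ j * ((x - 1) / 2) ^ (l - j)) *
          Complex.exp (Complex.I * ((j - i : ℤ) : ℂ) * θ)) =
      ∑ j ∈ Finset.range (l + 1), if j = i then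
        ((l.choose i : ℂ) * l.choose j * ((x + 1) / 2) ^ j * ((x - 1) / 2) ^ (l - j)) *
          ((2 * π : ℝ) : ℂ) else 0 := by
    rw [intervalIntegral.integral_finsetSum]
    swap
    · exact fun i _ => Continuous.intervalIntegrable (by fun_prop) _ _
    refine Finset.sum_congr rfl fun j _ => ?_
    rw [intervalIntegral.integral_const_mul, integral_exp_int_mul]
    have : (j : ℤ) - i = 0 ↔ j = i := by omega
    simp only [this]
    split_ifs <;> simp
  simp only [hin, Finset.sum_ite_eq']
  rw [legendreP]
  push_cast
  rw [Finset.mul_sum, Finset.mul_sum]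
  refine Finset.sum_congr rfl fun i hi => ?_
  have hi' : i ≤ l := by simpa [Nat.lt_succ_iff] using hi
  rw [if_pos hi, div_pow, div_pow]
  have h2 : (2 : ℂ) ^ l = 2 ^ i * 2 ^ (l - i) := by rw [← pow_add, Nat.add_sub_cancel' hi']
  rw [h2]
  field_simp

theorem reducedTrinomial_zero_eq_legendreP (x : ℝ) (l : ℕ) :
    reducedTrinomial ((x ^ 2 - 1) / 4) x l 0 = legendreP l x := by
  have h : (((x : ℂ) + 1) / 2) * ((x - 1) / 2) = (((x ^ 2 - 1) / 4 : ℝ) : ℂ) := by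
    push_cast; ring
  have hc := map_reducedTrinomial Complex.ofRealHom ((x ^ 2 - 1) / 4) x l 0
  simp only [Complex.ofRealHom_eq_coe] at hc
  have h1 := (trinomialFourier_eq (X := x) h l 0).1
  have h2 := trinomialFourier_legendre x l
  simp only [Nat.cast_zero, pow_zero, mul_one] at h1
  rw [h1, ← hc] at h2
  have hpi : (2 * π : ℂ) ≠ 0 := by exact_mod_cast two_pi_pos.ne'
  exact_mod_cast mul_left_cancel₀ hpi h2

theorem iteratedDeriv_legendreP (l m : ℕ) :
    ∃ c : ℝ, ∀ x, iteratedDeriv m (legendreP l) x =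
      c * reducedTrinomial ((x ^ 2 - 1) / 4) x l m := by
  induction m with
  | zero => exact ⟨1, fun x => by simp [reducedTrinomial_zero_eq_legendreP]⟩
  | succ m ih =>
    obtain ⟨c, hc⟩ := ih
    refine ⟨c * ((l + m + 1) / 2), fun x => ?_⟩
    rw [iteratedDeriv_succ, funext hc,
      ((hasDerivAt_reducedTrinomial l m x).const_mul c).deriv]
    ring

/-! ### Spherical harmonics and their circle averages -/

/-- The solid harmonic of degree `l` and order `-m` (up to a constant), through Laplace's
integral. -/
def solidHarm (l : ℕ) (m : ℤ) (x : R3) : ℂ :=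
  ∫ t in (0 : ℝ)..(2 * π), Complex.exp (-(Complex.I * m * t)) *
    (x 2 + Complex.I * (x 0 * cos t + x 1 * sin t)) ^ l

theorem continuous_solidHarm (l : ℕ) (m : ℤ) : Continuous (solidHarm l m) := by
  unfold solidHarm
  refine intervalIntegral.continuous_parametric_intervalIntegral_of_continuous' ?_ _ _
  have h (i : Fin 3) : Continuous fun q : R3 × ℝ => q.1 i := by fun_prop
  have h0 := h 0
  have h1 := h 1
  have h2 := h 2
  simp only [Function.uncurry_def]
  fun_prop

theorem sphVec_apply_zero (θ φ : ℝ) : sphVec θ φ 0 = sin φ * cos θ := rfl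
theorem sphVec_apply_one (θ φ : ℝ) : sphVec θ φ 1 = sin φ * sin θ := rfl
theorem sphVec_apply_two (θ φ : ℝ) : sphVec θ φ 2 = cos φ := rfl

theorem rotUV_apply_zero (α β : ℝ) (x : R3) :
    rotUV α β x 0 = cos α * (cos β * x 0 + sin β * x 2) - sin α * x 1 := rfl
theorem rotUV_apply_one (α β : ℝ) (x : R3) :
    rotUV α β x 1 = sin α * (cos β * x 0 + sin β * x 2) + cos α * x 1 := rfl
theorem rotUV_apply_two (α β : ℝ) (x : R3) :
    rotUV α β x 2 = -sin β * x 0 + cos β * x 2 := rfl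

theorem cos_eq_exp_add_exp (t : ℝ) : ((cos t : ℝ) : ℂ) =
    (Complex.exp (Complex.I * t) + Complex.exp (-(Complex.I * t))) / 2 := by
  rw [Complex.ofReal_cos, Complex.cos]
  congr 3 <;> ring_nf

theorem sin_eq_exp_sub_exp (t : ℝ) : ((sin t : ℝ) : ℂ) =
    (Complex.exp (-(Complex.I * t)) - Complex.exp (Complex.I * t)) * Complex.I / 2 := by
  rw [Complex.ofReal_sin, Complex.sin]
  congr 4 <;> ring_nf

theorem solidHarm_sphVec (l : ℕ) (m : ℤ) (θ φ : ℝ) :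
    solidHarm l m (sphVec θ φ) = 2 * π * (Complex.I / 2) ^ m.natAbs *
      (sin φ : ℂ) ^ m.natAbs * reducedTrinomial ((cos φ ^ 2 - 1) / 4) (cos φ) l m.natAbs *
        Complex.exp (-(Complex.I * m * θ)) := by
  set A : ℂ := Complex.I / 2 * sin φ * Complex.exp (-(Complex.I * θ)) with hA
  set B : ℂ := Complex.I / 2 * sin φ * Complex.exp (Complex.I * θ) with hB
  have hE : Complex.exp (Complex.I * θ) * Complex.exp (-(Complex.I * θ)) = 1 := by
    rw [← Complex.exp_add]; simp
  have hsc : ((sin φ : ℝ) : ℂ) ^ 2 + ((cos φ : ℝ) : ℂ) ^ 2 = 1 := by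
    exact_mod_cast sin_sq_add_cos_sq φ
  have hAB : A * B = (((cos φ ^ 2 - 1) / 4 : ℝ) : ℂ) := by
    rw [hA, hB]
    simp only [Complex.ofReal_div, Complex.ofReal_sub, Complex.ofReal_pow, Complex.ofReal_one,
      Complex.ofReal_ofNat]
    linear_combination (Complex.I ^ 2 / 4 * (sin φ : ℂ) ^ 2) * hE +
      ((sin φ : ℂ) ^ 2 / 4) * Complex.I_sq - hsc / 4
  have hZ : solidHarm l m (sphVec θ φ) = trinomialFourier (cos φ : ℝ) A B l m := by
    unfold solidHarm trinomialFourier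
    congr 1
    ext t
    rw [sphVec_apply_zero, sphVec_apply_one, sphVec_apply_two, hA, hB]
    congr 2
    simp only [Complex.ofReal_mul]
    rw [cos_eq_exp_add_exp t, cos_eq_exp_add_exp θ, sin_eq_exp_sub_exp t,
      sin_eq_exp_sub_exp θ]
    linear_combination (Complex.I * (sin φ : ℂ) * (Complex.exp (-(Complex.I * t)) -
      Complex.exp (Complex.I * t)) * (Complex.exp (-(Complex.I * θ)) -
      Complex.exp (Complex.I * θ)) / 4) * Complex.I_sq
  have hc := map_reducedTrinomial Complex.ofRealHom ((cos φ ^ 2 - 1) / 4) (cos φ) l m.natAbs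
  simp only [Complex.ofRealHom_eq_coe] at hc
  have key := trinomialFourier_eq (X := (cos φ : ℝ)) hAB l m.natAbs
  rw [hZ, hc]
  obtain ⟨n, rfl | rfl⟩ := m.eq_nat_or_neg
  · rw [Int.natAbs_natCast] at key ⊢
    have h1 : Complex.exp (-(Complex.I * ((n : ℤ) : ℂ) * θ)) =
        Complex.exp (-(Complex.I * θ)) ^ n := by
      rw [← Complex.exp_nat_mul]
      congr 1
      push_cast; ring
    rw [key.1, h1, hA]; ring
  · rw [Int.natAbs_neg, Int.natAbs_natCast] at key ⊢
    have h1 : Complex.exp (-(Complex.I * ((-(n : ℤ) : ℤ) : ℂ) * θ)) =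
        Complex.exp (Complex.I * θ) ^ n := by
      rw [← Complex.exp_nat_mul]
      congr 1
      push_cast; ring
    rw [key.2, h1, hB]; ring

theorem assocP_cos (l m : ℕ) : ∃ c : ℝ, ∀ φ ∈ Icc 0 π, assocP l m (cos φ) =
    c * sin φ ^ m * reducedTrinomial ((cos φ ^ 2 - 1) / 4) (cos φ) l m := by
  obtain ⟨c, hc⟩ := iteratedDeriv_legendreP l m
  refine ⟨(-1) ^ m * c, fun φ hφ => ?_⟩
  have h : (1 - cos φ ^ 2) ^ ((m : ℝ) / 2) = sin φ ^ m := by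
    rw [← sin_sq, ← rpow_natCast (sin φ) 2, ← rpow_mul (sin_nonneg_of_mem_Icc hφ),
      ← rpow_natCast (sin φ) m]
    congr 1; push_cast; ring
  rw [assocP, hc, h]; ring

theorem assocPZ_cos (l : ℕ) (m : ℤ) : ∃ c : ℝ, ∀ φ ∈ Icc 0 π, assocPZ l m (cos φ) =
    c * sin φ ^ m.natAbs *
      reducedTrinomial ((cos φ ^ 2 - 1) / 4) (cos φ) l m.natAbs := by
  obtain ⟨c, hc⟩ := assocP_cos l m.natAbs
  unfold assocPZ
  split_ifs with h
  · have : m.toNat = m.natAbs := by omega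
    exact ⟨c, fun φ hφ => by rw [this, hc φ hφ]⟩
  · exact ⟨_, fun φ hφ => by rw [hc φ hφ, ← mul_assoc, ← mul_assoc]⟩

theorem conj_sphHarm (l : ℕ) (m : ℤ) : ∃ c : ℂ, ∀ θ, ∀ φ ∈ Icc 0 π,
    conj (sphHarm l m θ φ) = c * solidHarm l m (sphVec θ φ) := by
  obtain ⟨d, hd⟩ := assocPZ_cos l m
  have hne : (2 * π * (Complex.I / 2) ^ m.natAbs : ℂ) ≠ 0 := by
    have : (π : ℂ) ≠ 0 := by exact_mod_cast pi_pos.ne'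
    simp [this]
  refine ⟨((((-1 : ℝ) ^ m * Real.sqrt ((2 * (l : ℝ) + 1) * (((l : ℤ) - m).toNat.factorial : ℝ) /
      (4 * π * (((l : ℤ) + m).toNat.factorial : ℝ)))) * d : ℝ) : ℂ) /
      (2 * π * (Complex.I / 2) ^ m.natAbs), fun θ φ hφ => ?_⟩
  have hexp : conj (Complex.exp (Complex.I * m * θ)) = Complex.exp (-(Complex.I * m * θ)) := by
    rw [← Complex.exp_conj]
    congr 1
    simp
  rw [solidHarm_sphVec, sphHarm, map_mul, Complex.conj_ofReal, hexp, hd φ hφ, div_mul_eq_mul_div,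
    eq_div_iff hne]
  push_cast
  ring

theorem integral_null_linear_pow {a b c : ℂ} (h : a ^ 2 + b ^ 2 + c ^ 2 = 0) (l : ℕ) (φ : ℝ) :
    ∫ θ in (0 : ℝ)..(2 * π), (a * (sin φ * cos θ : ℝ) + b * (sin φ * sin θ : ℝ) +
      c * (cos φ : ℝ)) ^ l = 2 * π * legendreP l (cos φ) * c ^ l := by
  have hsc : ((sin φ : ℝ) : ℂ) ^ 2 + ((cos φ : ℝ) : ℂ) ^ 2 = 1 := by
    exact_mod_cast sin_sq_add_cos_sq φ
  have hAB : ((sin φ : ℂ) * (a - Complex.I * b) / 2) * ((sin φ : ℂ) * (a + Complex.I * b) / 2) =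
      c ^ 2 * (((cos φ ^ 2 - 1) / 4 : ℝ) : ℂ) := by
    simp only [Complex.ofReal_div, Complex.ofReal_sub, Complex.ofReal_pow,
      Complex.ofReal_one, Complex.ofReal_ofNat]
    linear_combination (sin φ : ℂ) ^ 2 / 4 * h - (sin φ : ℂ) ^ 2 / 4 * b ^ 2 * Complex.I_sq -
      c ^ 2 / 4 * hsc
  have key := (trinomialFourier_eq (X := c * (cos φ : ℝ)) hAB l 0).1
  have hc := map_reducedTrinomial Complex.ofRealHom ((cos φ ^ 2 - 1) / 4) (cos φ) l 0
  have hs := pow_mul_reducedTrinomial (((cos φ ^ 2 - 1) / 4 : ℝ) : ℂ) ((cos φ : ℝ) : ℂ) c l 0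
  simp only [Complex.ofRealHom_eq_coe] at hc
  rw [pow_zero, one_mul] at hs
  rw [hs, ← hc, reducedTrinomial_zero_eq_legendreP] at key
  trans trinomialFourier (c * (cos φ : ℝ)) ((sin φ : ℂ) * (a - Complex.I * b) / 2)
    ((sin φ : ℂ) * (a + Complex.I * b) / 2) l ((0 : ℕ) : ℤ)
  · unfold trinomialFourier
    congr 1
    ext θ
    simp only [Nat.cast_zero, Int.cast_zero, mul_zero, zero_mul, neg_zero, Complex.exp_zero,
      one_mul]
    congr 1
    simp only [Complex.ofReal_mul]
    rw [cos_eq_exp_add_exp θ, sin_eq_exp_sub_exp θ]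
    ring
  · rw [key]; ring

theorem integral_solidHarm_rotUV (l : ℕ) (m : ℤ) (α β φ : ℝ) :
    ∫ θ in (0 : ℝ)..(2 * π), solidHarm l m (rotUV α β (sphVec θ φ)) =
      2 * π * legendreP l (cos φ) * solidHarm l m (sphVec α β) := by
  have hα : ((sin α : ℝ) : ℂ) ^ 2 + ((cos α : ℝ) : ℂ) ^ 2 = 1 := by
    exact_mod_cast sin_sq_add_cos_sq α
  have hβ : ((sin β : ℝ) : ℂ) ^ 2 + ((cos β : ℝ) : ℂ) ^ 2 = 1 := by
    exact_mod_cast sin_sq_add_cos_sq β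
  unfold solidHarm
  simp only [rotUV_apply_zero, rotUV_apply_one, rotUV_apply_two, sphVec_apply_zero,
    sphVec_apply_one, sphVec_apply_two]
  rw [intervalIntegral_intervalIntegral_swap, ← intervalIntegral.integral_const_mul]
  · congr 1
    ext t
    have ht : ((sin t : ℝ) : ℂ) ^ 2 + ((cos t : ℝ) : ℂ) ^ 2 = 1 := by
      exact_mod_cast sin_sq_add_cos_sq t
    have hnull : (Complex.I * (cos t * cos α * cos β + sin t * sin α * cos β) - sin β : ℂ) ^ 2 +
        (Complex.I * (-cos t * sin α + sin t * cos α) : ℂ) ^ 2 +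
        (cos β + Complex.I * (sin β * cos α * cos t + sin β * sin α * sin t) : ℂ) ^ 2 = 0 := by
      simp only [Complex.ofReal_cos, Complex.ofReal_sin] at hα hβ ht ⊢
      linear_combination
        (Complex.I ^ 2 * (Complex.cos t * Complex.cos α + Complex.sin t * Complex.sin α) ^ 2 + 1) * hβ +
          ((Complex.cos t * Complex.cos α + Complex.sin t * Complex.sin α) ^ 2 +
            (-Complex.cos t * Complex.sin α + Complex.sin t * Complex.cos α) ^ 2) * Complex.I_sq -
          (Complex.cos t ^ 2 + Complex.sin t ^ 2) * hα - ht
    have key := integral_null_linear_pow hnull l φ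
    rw [intervalIntegral.integral_const_mul]
    trans Complex.exp (-(Complex.I * m * t)) * (2 * π * legendreP l (cos φ) *
      (cos β + Complex.I * (sin β * cos α * cos t + sin β * sin α * sin t) : ℂ) ^ l)
    · rw [← key]
      congr 2
      ext θ
      congr 1
      push_cast
      ring
    · push_cast
      ring
  · refine IntegrableOn.mono_set (t := uIcc 0 (2 * π) ×ˢ uIcc 0 (2 * π)) ?_
      (prod_mono uIoc_subset_uIcc uIoc_subset_uIcc)
    refine ContinuousOn.integrableOn_compact (isCompact_uIcc.prod isCompact_uIcc)
      (Continuous.continuousOn ?_)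
    simp only [Function.uncurry_def]
    fun_prop

/-! ### The surface measure of the unit sphere -/

/-- Lebesgue measure on the azimuth interval. -/
def azimuthMeasure : Measure ℝ := volume.restrict (Ioo 0 (2 * π))

/-- The measure `sin φ dφ` on the colatitude interval. -/
def colatitudeMeasure : Measure ℝ :=
  (volume.restrict (Ioo 0 π)).withDensity fun φ => ENNReal.ofReal (sin φ)

/-- The surface measure of the unit sphere, in spherical coordinates. -/
def sphereMeasure : Measure R3 :=
  (azimuthMeasure.prod colatitudeMeasure).map fun q => sphVec q.1 q.2

instance : IsFiniteMeasure azimuthMeasure := by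
  unfold azimuthMeasure; infer_instance

instance : IsFiniteMeasure colatitudeMeasure := by
  refine isFiniteMeasure_withDensity_ofReal ?_
  have : IntegrableOn sin (Icc 0 π) := continuous_sin.continuousOn.integrableOn_compact isCompact_Icc
  exact (this.mono_set Ioo_subset_Icc_self).2

theorem measurable_sphVec : Measurable fun q : ℝ × ℝ => sphVec q.1 q.2 := by
  unfold sphVec
  refine (MeasurableEquiv.toLp 2 (Fin 3 → ℝ)).measurable.comp (measurable_pi_lambda _ fun i => ?_)
  fin_cases i <;> simp <;> fun_prop

instance : IsFiniteMeasure sphereMeasure := by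
  unfold sphereMeasure; infer_instance

theorem lintegral_R3_eq_coordinates (G : R3 → ENNReal) (hG : Measurable G) :
    ∫⁻ x, G x = ∫⁻ z : ℝ, ∫⁻ q : ℝ × ℝ, G (WithLp.toLp 2 ![q.1, q.2, z]) := by
  have e1 := EuclideanSpace.volume_preserving_symm_measurableEquiv_toLp (Fin 3)
  have e2 := volume_preserving_piFinSuccAbove (fun _ : Fin 3 => ℝ) 2
  have e3 := (MeasurePreserving.id (volume : Measure ℝ)).prod (volume_preserving_finTwoArrow ℝ)
  have e := e3.comp (e2.comp e1)
  have hm : Measurable fun w : ℝ × ℝ × ℝ => G (WithLp.toLp 2 ![w.2.1, w.2.2, w.1]) := by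
    refine hG.comp ((MeasurableEquiv.toLp 2 (Fin 3 → ℝ)).measurable.comp
      (measurable_pi_lambda _ fun i => ?_))
    fin_cases i <;> simp <;> fun_prop
  rw [← lintegral_prod _ hm.aemeasurable, ← e.lintegral_comp hm]
  refine lintegral_congr fun x => congrArg G ?_
  ext i
  fin_cases i <;> rfl

theorem lintegral_plane_eq_polar (G : ℝ × ℝ → ENNReal) (hG : Measurable G) :
    ∫⁻ q, G q = ∫⁻ s in Ioi (0 : ℝ), ∫⁻ θ, ENNReal.ofReal s * G (s * cos θ, s * sin θ)
      ∂azimuthMeasure := by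
  have hm : Measurable fun p : ℝ × ℝ =>
      ENNReal.ofReal p.1 * G (-(p.1 * cos p.2), -(p.1 * sin p.2)) := by
    fun_prop
  rw [← lintegral_neg_eq_self G, ← lintegral_comp_polarCoord_symm, polarCoord_target,
    Measure.volume_eq_prod, ← Measure.prod_restrict]
  simp only [polarCoord_symm_apply, smul_eq_mul, Prod.neg_mk]
  rw [lintegral_prod _ hm.aemeasurable]
  refine lintegral_congr fun s => ?_
  have h := (measurePreserving_add_right (volume : Measure ℝ) π).restrict_preimage
    (measurableSet_Ioo (a := (0 : ℝ)) (b := 2 * π))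
  have hpre : (fun x => x + π) ⁻¹' Ioo 0 (2 * π) = Ioo (-π) π := by
    rw [preimage_add_const_Ioo]; congr 1 <;> ring
  rw [hpre] at h
  rw [azimuthMeasure, ← h.lintegral_comp (by fun_prop)]
  simp [cos_add_pi, sin_add_pi]

theorem lintegral_sphereMeasure (g : R3 → ENNReal) (hg : Measurable g) :
    ∫⁻ x, g x ∂sphereMeasure = ∫⁻ φ in Ioo 0 π, ENNReal.ofReal (sin φ) *
      ∫⁻ θ, g (sphVec θ φ) ∂azimuthMeasure := by
  have hm : Measurable fun q : ℝ × ℝ => g (sphVec q.1 q.2) := hg.comp measurable_sphVec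
  rw [sphereMeasure, lintegral_map hg measurable_sphVec, lintegral_prod_symm _ hm.aemeasurable,
    colatitudeMeasure, lintegral_withDensity_eq_lintegral_mul _ (by fun_prop)
      hm.lintegral_prod_left']
  rfl

theorem lintegral_R3_eq_spherical (G : R3 → ENNReal) (hG : Measurable G) :
    ∫⁻ x, G x = ∫⁻ R in Ioi (0 : ℝ), ENNReal.ofReal (R ^ 2) *
      ∫⁻ x, G (R • x) ∂sphereMeasure := by
  have hvec : Measurable fun w : ℝ × ℝ × ℝ => (WithLp.toLp 2 ![w.1, w.2.1, w.2.2] : R3) := by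
    refine (MeasurableEquiv.toLp 2 (Fin 3 → ℝ)).measurable.comp
      (measurable_pi_lambda _ fun i => ?_)
    fin_cases i <;> simp <;> fun_prop
  set F : ℝ × ℝ → ENNReal := fun q => ∫⁻ θ, ENNReal.ofReal q.2 *
    G (WithLp.toLp 2 ![q.2 * cos θ, q.2 * sin θ, q.1]) ∂azimuthMeasure with hF
  have hFm : Measurable F := by
    refine Measurable.lintegral_prod_right' (f := fun w : (ℝ × ℝ) × ℝ => ENNReal.ofReal w.1.2 *
      G (WithLp.toLp 2 ![w.1.2 * cos w.2, w.1.2 * sin w.2, w.1.1])) ?_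
    refine Measurable.mul (by fun_prop) (hG.comp ?_)
    exact hvec.comp (g := fun w : ℝ × ℝ × ℝ => (WithLp.toLp 2 ![w.1, w.2.1, w.2.2] : R3))
      (f := fun w : (ℝ × ℝ) × ℝ => (w.1.2 * cos w.2, w.1.2 * sin w.2, w.1.1)) (by fun_prop)
  have hS : MeasurableSet {q : ℝ × ℝ | 0 < q.2} := measurableSet_lt measurable_const measurable_snd
  have h1 : ∫⁻ x, G x = ∫⁻ q, {q : ℝ × ℝ | 0 < q.2}.indicator F q := by
    have hp := lintegral_prod (μ := (volume : Measure ℝ)) (ν := (volume : Measure ℝ)) _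
      (hFm.indicator hS).aemeasurable
    rw [← Measure.volume_eq_prod] at hp
    rw [lintegral_R3_eq_coordinates G hG, hp]
    refine lintegral_congr fun z => ?_
    rw [lintegral_plane_eq_polar (fun q => G (WithLp.toLp 2 ![q.1, q.2, z]))
      (hG.comp (hvec.comp (g := fun w : ℝ × ℝ × ℝ => (WithLp.toLp 2 ![w.1, w.2.1, w.2.2] : R3))
        (f := fun q : ℝ × ℝ => (q.1, q.2, z)) (by fun_prop))),
      ← lintegral_indicator measurableSet_Ioi]
    rfl
  rw [h1, lintegral_plane_eq_polar _ (hFm.indicator hS)]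
  refine setLIntegral_congr_fun measurableSet_Ioi fun R (hR : 0 < R) => ?_
  rw [lintegral_sphereMeasure (fun x => G (R • x)) (hG.comp (measurable_const_smul R)),
    azimuthMeasure, ← lintegral_const_mul' _ _ ENNReal.ofReal_ne_top]
  have h2 (φ : ℝ) (hφ : φ ∈ Ioo 0 (2 * π)) : ENNReal.ofReal R *
      {q : ℝ × ℝ | 0 < q.2}.indicator F (R * cos φ, R * sin φ) =
      (Ioo 0 π).indicator (fun φ => ENNReal.ofReal R * F (R * cos φ, R * sin φ)) φ := by
    by_cases h : φ < π
    · have : 0 < R * sin φ := mul_pos hR (sin_pos_of_pos_of_lt_pi hφ.1 h)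
      rw [indicator_of_mem (by exact this), indicator_of_mem (show φ ∈ Ioo 0 π from ⟨hφ.1, h⟩)]
    · have hs : sin φ ≤ 0 := by
        have := sin_nonneg_of_nonneg_of_le_pi (x := φ - π) (by linarith) (by linarith [hφ.2])
        rw [sin_sub_pi] at this; linarith
      have : ¬ 0 < R * sin φ := not_lt.2 (mul_nonpos_of_nonneg_of_nonpos hR.le hs)
      rw [indicator_of_notMem (by exact this), indicator_of_notMem (fun h' => h h'.2), mul_zero]
  rw [setLIntegral_congr_fun measurableSet_Ioo h2, setLIntegral_indicator measurableSet_Ioo,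
    inter_eq_left.2 (Ioo_subset_Ioo_right (by linarith [pi_pos]))]
  refine setLIntegral_congr_fun measurableSet_Ioo fun φ hφ => ?_
  rw [hF]
  simp only
  rw [lintegral_const_mul' _ _ ENNReal.ofReal_ne_top, ← azimuthMeasure, ← mul_assoc, ← mul_assoc,
    ← ENNReal.ofReal_mul hR.le, ← ENNReal.ofReal_mul (sq_nonneg R)]
  congr 2
  · ring
  · funext θ
    refine congrArg G ?_
    ext i
    fin_cases i <;> simp [sphVec, mul_assoc]

theorem norm_sphVec (θ φ : ℝ) : ‖sphVec θ φ‖ = 1 := by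
  rw [EuclideanSpace.norm_eq, sqrt_eq_one, Fin.sum_univ_three]
  simp only [sphVec, WithLp.equiv_symm_apply, Matrix.cons_val_zero, Matrix.cons_val_one,
    Matrix.cons_val, norm_eq_abs, sq_abs]
  linear_combination sin φ ^ 2 * sin_sq_add_cos_sq θ + sin_sq_add_cos_sq φ

/-- The surface measure is invariant under linear isometries. -/
theorem measurePreserving_sphereMeasure (e : R3 ≃ₗᵢ[ℝ] R3) :
    MeasurePreserving e sphereMeasure sphereMeasure := by
  have key (g : R3 → ENNReal) (hg : Measurable g) :
      ∫⁻ x, (Metric.ball 0 1).indicator (fun x : R3 => g (‖x‖⁻¹ • x)) x =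
        (∫⁻ R in Ioi (0 : ℝ), ENNReal.ofReal (R ^ 2) * (Iio 1).indicator 1 R) *
          ∫⁻ x, g x ∂sphereMeasure := by
    have hgm : Measurable fun x : R3 => g (‖x‖⁻¹ • x) := hg.comp (by fun_prop)
    have hm := hgm.indicator (Metric.isOpen_ball (x := (0 : R3)) (ε := 1)).measurableSet
    rw [lintegral_R3_eq_spherical _ hm, ← lintegral_mul_const]
    swap
    · exact Measurable.mul (by fun_prop) (measurable_one.indicator measurableSet_Iio)
    refine setLIntegral_congr_fun measurableSet_Ioi fun R (hR : 0 < R) => ?_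
    rw [mul_assoc]
    congr 1
    rw [lintegral_sphereMeasure (fun x => (Metric.ball (0 : R3) 1).indicator
        (fun x : R3 => g (‖x‖⁻¹ • x)) (R • x)) (hm.comp (measurable_const_smul R)),
      lintegral_sphereMeasure _ hg]
    have hnorm (θ φ : ℝ) : ‖R • sphVec θ φ‖ = R := by
      rw [norm_smul, norm_sphVec, mul_one, norm_of_nonneg hR.le]
    by_cases h : R < 1
    · rw [indicator_of_mem (by exact h), Pi.one_apply, one_mul]
      have (θ φ : ℝ) : R • sphVec θ φ ∈ Metric.ball (0 : R3) 1 := by simpa [hnorm] using h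
      simp only [indicator_of_mem (this _ _), hnorm, smul_smul, inv_mul_cancel₀ hR.ne', one_smul]
    · rw [indicator_of_notMem (by exact h), zero_mul]
      have (θ φ : ℝ) : R • sphVec θ φ ∉ Metric.ball (0 : R3) 1 := by simpa [hnorm] using h
      simp [indicator_of_notMem (this _ _)]
  set c := ∫⁻ R in Ioi (0 : ℝ), ENNReal.ofReal (R ^ 2) * (Iio 1).indicator 1 R with hc
  have hc_eq : c = ∫⁻ R in Ioo (0 : ℝ) 1, ENNReal.ofReal (R ^ 2) := by
    have : ∀ R, ENNReal.ofReal (R ^ 2) * (Iio (1 : ℝ)).indicator 1 R =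
        (Iio (1 : ℝ)).indicator (fun R => ENNReal.ofReal (R ^ 2)) R := fun R => by
      by_cases h : R ∈ Iio (1 : ℝ) <;> simp [h]
    rw [hc]
    simp only [this]
    rw [setLIntegral_indicator measurableSet_Iio, inter_comm, Ioi_inter_Iio]
  have hc_top : c ≠ ⊤ := by
    rw [hc_eq]
    have : IntegrableOn (fun R : ℝ => R ^ 2) (Icc 0 1) :=
      (continuous_pow 2).continuousOn.integrableOn_compact isCompact_Icc
    exact ((hasFiniteIntegral_iff_ofReal (by exact ae_of_all _ fun R => sq_nonneg R)).1
      (this.mono_set Ioo_subset_Icc_self).2).ne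
  have hc_zero : c ≠ 0 := by
    rw [hc_eq, ← pos_iff_ne_zero, setLIntegral_pos_iff (by fun_prop)]
    refine lt_of_lt_of_le ?_ (measure_mono (s := Ioo (0 : ℝ) 1) fun R hR => ⟨?_, hR⟩)
    · simp
    · simp [hR.1.ne']
  refine ⟨e.continuous.measurable, Measure.ext_of_lintegral _ fun g hg => ?_⟩
  rw [lintegral_map hg e.continuous.measurable]
  have h1 := key g hg
  have h2 := key (fun x => g (e x)) (hg.comp e.continuous.measurable)
  have h3 : ∫⁻ x, (Metric.ball 0 1).indicator (fun x : R3 => g (e (‖x‖⁻¹ • x))) x =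
      ∫⁻ x, (Metric.ball 0 1).indicator (fun x : R3 => g (‖x‖⁻¹ • x)) x := by
    have hgm : Measurable fun x : R3 => g (‖x‖⁻¹ • x) := hg.comp (by fun_prop)
    have hm := hgm.indicator (Metric.isOpen_ball (x := (0 : R3)) (ε := 1)).measurableSet
    rw [← e.measurePreserving.lintegral_comp hm]
    refine lintegral_congr fun x => ?_
    by_cases h : x ∈ Metric.ball (0 : R3) 1
    · rw [indicator_of_mem h, indicator_of_mem (by simpa using h), map_smul, e.norm_map]
    · rw [indicator_of_notMem h, indicator_of_notMem (by simpa using h)]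
  rw [h2, h1] at h3
  exact (ENNReal.mul_right_inj hc_zero hc_top).1 h3

/-! ### Integration over the sphere -/

/-- The rotation `h = U(α)V(β)` as a linear isometry equivalence. -/
def rotUVEquiv (α β : ℝ) : R3 ≃ₗᵢ[ℝ] R3 :=
  LinearIsometry.toLinearIsometryEquiv
    { toFun := rotUV α β
      map_add' := fun x y => by
        ext i; fin_cases i <;> simp [rotUV, rotZ, rotY] <;> ring
      map_smul' := fun c x => by
        ext i; fin_cases i <;> simp [rotUV, rotZ, rotY] <;> ring
      norm_map' := fun x => by
        rw [EuclideanSpace.norm_eq, EuclideanSpace.norm_eq]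
        congr 1
        simp only [Fin.sum_univ_three, norm_eq_abs, sq_abs, LinearMap.coe_mk, AddHom.coe_mk,
          rotUV_apply_zero, rotUV_apply_one, rotUV_apply_two]
        linear_combination ((cos β * x 0 + sin β * x 2) ^ 2 + x 1 ^ 2) * sin_sq_add_cos_sq α +
          (x 0 ^ 2 + x 2 ^ 2) * sin_sq_add_cos_sq β } rfl

theorem inner_rotUV_sphVec (α β : ℝ) (x : R3) :
    inner ℝ (rotUV α β x) (sphVec α β) = x 2 := by
  rw [PiLp.inner_apply, Fin.sum_univ_three]
  simp only [rotUV_apply_zero, rotUV_apply_one, rotUV_apply_two, sphVec_apply_zero,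
    sphVec_apply_one, sphVec_apply_two, RCLike.inner_apply, conj_trivial]
  linear_combination (sin β * (cos β * x 0 + sin β * x 2)) * sin_sq_add_cos_sq α +
    x 2 * sin_sq_add_cos_sq β

theorem measurePreserving_rotUV (α β : ℝ) :
    MeasurePreserving (rotUV α β) sphereMeasure sphereMeasure :=
  measurePreserving_sphereMeasure (rotUVEquiv α β)

theorem integral_comp_rotUV {E : Type*} [NormedAddCommGroup E] [NormedSpace ℝ E] (α β : ℝ)
    (g : R3 → E) : ∫ x, g (rotUV α β x) ∂sphereMeasure = ∫ x, g x ∂sphereMeasure :=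
  (measurePreserving_rotUV α β).integral_comp
    (rotUVEquiv α β).toHomeomorph.measurableEmbedding g

theorem integral_azimuthMeasure {E : Type*} [NormedAddCommGroup E] [NormedSpace ℝ E]
    (g : ℝ → E) : ∫ θ, g θ ∂azimuthMeasure = ∫ θ in (0 : ℝ)..(2 * π), g θ := by
  rw [azimuthMeasure, intervalIntegral.integral_of_le (by positivity), integral_Ioc_eq_integral_Ioo]

theorem integral_colatitudeMeasure {E : Type*} [NormedAddCommGroup E] [NormedSpace ℝ E]
    (g : ℝ → E) : ∫ φ, g φ ∂colatitudeMeasure = ∫ φ in (0 : ℝ)..π, sin φ • g φ := by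
  rw [colatitudeMeasure, integral_withDensity_eq_integral_toReal_smul (by fun_prop)
    (ae_of_all _ fun _ => ENNReal.ofReal_lt_top),
    intervalIntegral.integral_of_le pi_pos.le, integral_Ioc_eq_integral_Ioo]
  refine setIntegral_congr_fun measurableSet_Ioo fun φ hφ => ?_
  rw [ENNReal.toReal_ofReal (sin_pos_of_mem_Ioo hφ).le]

theorem integrable_comp_sphVec {E : Type*} [NormedAddCommGroup E] {g : R3 → E}
    (hg : Integrable g sphereMeasure) :
    Integrable (fun q : ℝ × ℝ => g (sphVec q.1 q.2)) (azimuthMeasure.prod colatitudeMeasure) :=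
  hg.comp_measurable measurable_sphVec

theorem integral_sphereMeasure {E : Type*} [NormedAddCommGroup E] [NormedSpace ℝ E]
    {g : R3 → E} (hg : Integrable g sphereMeasure) :
    ∫ x, g x ∂sphereMeasure = ∫ θ, ∫ φ, g (sphVec θ φ) ∂colatitudeMeasure ∂azimuthMeasure := by
  rw [← integral_prod _ (integrable_comp_sphVec hg)]
  exact integral_map measurable_sphVec.aemeasurable hg.aestronglyMeasurable

theorem integral_sphereMeasure_symm {E : Type*} [NormedAddCommGroup E] [NormedSpace ℝ E]
    {g : R3 → E} (hg : Integrable g sphereMeasure) :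
    ∫ x, g x ∂sphereMeasure = ∫ φ, ∫ θ, g (sphVec θ φ) ∂azimuthMeasure ∂colatitudeMeasure := by
  rw [← integral_prod_symm _ (integrable_comp_sphVec hg)]
  exact integral_map measurable_sphVec.aemeasurable hg.aestronglyMeasurable

theorem ae_norm_eq_one : ∀ᵐ x ∂sphereMeasure, ‖x‖ = 1 :=
  (ae_map_iff measurable_sphVec.aemeasurable
    (isClosed_eq continuous_norm continuous_const).measurableSet).2
    (ae_of_all _ fun q => norm_sphVec q.1 q.2)

theorem integrable_sphereMeasure {g : R3 → ℂ} (hg : Continuous g) :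
    Integrable g sphereMeasure := by
  obtain ⟨C, hC⟩ := (isCompact_sphere (0 : R3) 1).exists_bound_of_continuousOn hg.continuousOn
  refine Integrable.of_bound hg.aestronglyMeasurable C ?_
  filter_upwards [ae_norm_eq_one] with x hx using hC x (by simpa using hx)

theorem ae_colatitudeMeasure : ∀ᵐ φ ∂colatitudeMeasure, φ ∈ Ioo 0 π :=
  withDensity_absolutelyContinuous _ _ (ae_restrict_mem measurableSet_Ioo)

/-! ### The zonal transform -/

section Zonal

variable {K R : ℝ → ℝ} {f : R3 → ℝ} {C M : ℝ}

/-- The kernel whose integral over `x` is the transform at the axis `y`. -/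
def zonalKernel (K R : ℝ → ℝ) (f : R3 → ℝ) (x y : R3) : ℝ :=
  K (arccos (inner ℝ x y)) * f (R (arccos (inner ℝ x y)) • x)

theorem measurable_zonalKernel (hK : Measurable K) (hR : Measurable R) (hf : Continuous f)
    {X : Type*} [MeasurableSpace X] {u v : X → R3} (hu : Measurable u) (hv : Measurable v) :
    Measurable fun q => zonalKernel K R f (u q) (v q) := by
  have h : Measurable fun q => arccos (inner ℝ (u q) (v q)) :=
    continuous_arccos.measurable.comp (hu.inner hv)
  exact (hK.comp h).mul (hf.measurable.comp ((hR.comp h).smul hu))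

theorem norm_zonalKernel_le (hC : ∀ φ, |K φ| ≤ C) (hM : ∀ x, |f x| ≤ M) (x y : R3) :
    ‖zonalKernel K R f x y‖ ≤ C * M := by
  rw [zonalKernel, norm_mul]
  exact mul_le_mul (hC _) (hM _) (abs_nonneg _) ((abs_nonneg _).trans (hC 0))

theorem integral_zonalKernel (hK : Measurable K) (hR : Measurable R) (hf : Continuous f)
    (hC : ∀ φ, |K φ| ≤ C) (hM : ∀ x, |f x| ≤ M) (α β : ℝ) :
    ∫ x, zonalKernel K R f x (sphVec α β) ∂sphereMeasure =
      ∫ θ in (0 : ℝ)..(2 * π), ∫ φ in (0 : ℝ)..π,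
        sin φ * (K φ * f (R φ • rotUV α β (sphVec θ φ))) := by
  have hm : Measurable fun x => zonalKernel K R f (rotUV α β x) (sphVec α β) :=
    measurable_zonalKernel hK hR hf (measurePreserving_rotUV α β).measurable measurable_const
  have hint : Integrable (fun x => zonalKernel K R f (rotUV α β x) (sphVec α β)) sphereMeasure :=
    Integrable.of_bound hm.aestronglyMeasurable (C * M)
      (ae_of_all _ fun x => norm_zonalKernel_le hC hM _ _)
  rw [← integral_comp_rotUV α β, integral_sphereMeasure hint, integral_azimuthMeasure]
  refine intervalIntegral.integral_congr fun θ _ => ?_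
  rw [integral_colatitudeMeasure]
  refine intervalIntegral.integral_congr fun φ hφ => ?_
  rw [uIcc_of_le pi_pos.le] at hφ
  simp only [zonalKernel]
  rw [inner_rotUV_sphVec, sphVec_apply_two, arccos_cos hφ.1 hφ.2, smul_eq_mul]

theorem integrable_zonalKernel_mul (hK : Measurable K) (hR : Measurable R) (hf : Continuous f)
    (hC : ∀ φ, |K φ| ≤ C) (hM : ∀ x, |f x| ≤ M) {S : R3 → ℂ} (hS : Continuous S) :
    Integrable (fun q : R3 × R3 => (zonalKernel K R f q.1 q.2 : ℂ) * S q.2)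
      (sphereMeasure.prod sphereMeasure) := by
  refine ((integrable_sphereMeasure hS).comp_snd sphereMeasure).bdd_mul (c := C * M)
    (Complex.measurable_ofReal.comp
      (measurable_zonalKernel hK hR hf measurable_fst measurable_snd)).aestronglyMeasurable
    (ae_of_all _ fun q => ?_)
  rw [Complex.norm_real]
  exact norm_zonalKernel_le hC hM _ _

theorem integral_zonalKernel_mul_solidHarm (hK : Measurable K) (hR : Measurable R)
    (hf : Continuous f) (hC : ∀ φ, |K φ| ≤ C) (hM : ∀ x, |f x| ≤ M) (l : ℕ) (m : ℤ) (α β : ℝ) :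
    ∫ y, (zonalKernel K R f (sphVec α β) y : ℂ) * solidHarm l m y ∂sphereMeasure =
      ∫ φ, ((2 * π * K φ * legendreP l (cos φ) : ℝ) : ℂ) *
        ((f (R φ • sphVec α β) : ℂ) * solidHarm l m (sphVec α β)) ∂colatitudeMeasure := by
  have hrot := (measurePreserving_rotUV α β).measurable
  have hcont : Continuous fun y => solidHarm l m (rotUV α β y) :=
    (continuous_solidHarm l m).comp (rotUVEquiv α β).continuous
  have hm : Measurable fun y => zonalKernel K R f (sphVec α β) (rotUV α β y) :=
    measurable_zonalKernel hK hR hf measurable_const hrot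
  have hint : Integrable (fun y => (zonalKernel K R f (sphVec α β) (rotUV α β y) : ℂ) *
      solidHarm l m (rotUV α β y)) sphereMeasure := by
    refine (integrable_sphereMeasure hcont).bdd_mul (c := C * M)
      (Complex.measurable_ofReal.comp hm).aestronglyMeasurable (ae_of_all _ fun q => ?_)
    rw [Complex.norm_real]
    exact norm_zonalKernel_le hC hM _ _
  rw [← integral_comp_rotUV α β, integral_sphereMeasure_symm hint]
  refine integral_congr_ae ?_
  filter_upwards [ae_colatitudeMeasure] with φ hφ
  have h (θ : ℝ) : zonalKernel K R f (sphVec α β) (rotUV α β (sphVec θ φ)) =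
      K φ * f (R φ • sphVec α β) := by
    rw [zonalKernel, real_inner_comm, inner_rotUV_sphVec, sphVec_apply_two,
      arccos_cos hφ.1.le hφ.2.le]
  simp only [h]
  rw [integral_azimuthMeasure, intervalIntegral.integral_const_mul, integral_solidHarm_rotUV]
  push_cast
  ring

theorem integral_integral_zonalKernel_mul_solidHarm (hK : Measurable K) (hR : Measurable R)
    (hf : Continuous f) (hC : ∀ φ, |K φ| ≤ C) (hM : ∀ x, |f x| ≤ M) (l : ℕ) (m : ℤ) :
    ∫ y, ((∫ x, zonalKernel K R f x y ∂sphereMeasure : ℝ) : ℂ) * solidHarm l m y ∂sphereMeasure =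
      ∫ φ, ((2 * π * K φ * legendreP l (cos φ) : ℝ) : ℂ) *
        ∫ x, (f (R φ • x) : ℂ) * solidHarm l m x ∂sphereMeasure ∂colatitudeMeasure := by
  have hint := integrable_zonalKernel_mul hK hR hf hC hM (continuous_solidHarm l m)
  have hPc : Continuous fun φ => legendreP l (cos φ) := by
    unfold legendreP
    fun_prop
  obtain ⟨D, hD⟩ := isCompact_Icc.exists_bound_of_continuousOn (s := Icc 0 π) hPc.continuousOn
  have hint' : Integrable (fun q : R3 × ℝ => ((2 * π * K q.2 * legendreP l (cos q.2) : ℝ) : ℂ) *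
      ((f (R q.2 • q.1) : ℂ) * solidHarm l m q.1)) (sphereMeasure.prod colatitudeMeasure) := by
    have hD' : ∀ᵐ q ∂sphereMeasure.prod colatitudeMeasure, q.2 ∈ Ioo 0 π :=
      Measure.quasiMeasurePreserving_snd.ae ae_colatitudeMeasure
    refine Integrable.bdd_mul (c := 2 * π * C * D) (Integrable.bdd_mul (c := M)
      ((integrable_sphereMeasure (continuous_solidHarm l m)).comp_fst colatitudeMeasure) ?_
      (ae_of_all _ fun q => ?_)) ?_ ?_
    · exact (Complex.measurable_ofReal.comp (hf.measurable.comp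
        ((hR.comp measurable_snd).smul measurable_fst))).aestronglyMeasurable
    · rw [Complex.norm_real]; exact hM _
    · exact (Complex.measurable_ofReal.comp (((hK.comp measurable_snd).const_mul _).mul
        (hPc.measurable.comp measurable_snd))).aestronglyMeasurable
    · filter_upwards [hD'] with q hq
      rw [Complex.norm_real, norm_mul, norm_mul, norm_of_nonneg (by positivity)]
      have h1 := hC q.2
      have h2 := hD q.2 (Ioo_subset_Icc_self hq)
      have h3 := (abs_nonneg _).trans h1
      rw [norm_eq_abs (K _)]
      gcongr
  calc _ = ∫ y, ∫ x, (zonalKernel K R f x y : ℂ) * solidHarm l m y ∂sphereMeasure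
        ∂sphereMeasure := by
        refine integral_congr_ae (ae_of_all _ fun y => ?_)
        simp only
        rw [integral_mul_const, integral_complex_ofReal]
    _ = ∫ x, ∫ y, (zonalKernel K R f x y : ℂ) * solidHarm l m y ∂sphereMeasure
        ∂sphereMeasure := (integral_integral_swap hint).symm
    _ = ∫ x, ∫ φ, ((2 * π * K φ * legendreP l (cos φ) : ℝ) : ℂ) *
        ((f (R φ • x) : ℂ) * solidHarm l m x) ∂colatitudeMeasure ∂sphereMeasure := by
        rw [integral_sphereMeasure hint.integral_prod_left,
          integral_sphereMeasure hint'.integral_prod_left]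
        simp only [integral_zonalKernel_mul_solidHarm hK hR hf hC hM]
    _ = _ := by
        rw [integral_integral_swap hint']
        simp only [integral_const_mul]

end Zonal

/-! ### The symmetric curve -/

section Curve

variable {p : ℝ → ℝ} {r φ : ℝ}

theorem mul_sin_mem_Icc (hr : r ∈ Icc (0 : ℝ) 1) (hφ : φ ∈ Icc 0 π) : r * sin φ ∈ Icc (0 : ℝ) 1 :=
  ⟨mul_nonneg hr.1 (sin_nonneg_of_mem_Icc hφ),
    mul_le_one₀ hr.2 (sin_nonneg_of_mem_Icc hφ) (sin_le_one φ)⟩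

theorem continuousOn_curveρ (hp : ContDiffOn ℝ 1 p (Icc 0 (π / 2))) (hr : r ∈ Icc (0 : ℝ) 1) :
    ContinuousOn (curveρ p r) (Icc 0 π) := by
  refine hp.continuousOn.comp (by fun_prop) fun φ hφ => ?_
  exact ⟨arcsin_nonneg.2 (mul_sin_mem_Icc hr hφ).1, arcsin_le_pi_div_two _⟩

theorem exists_bound_deriv_curveρ (hp : ContDiffOn ℝ 1 p (Icc 0 (π / 2)))
    (hr : r ∈ Icc (0 : ℝ) 1) : ∃ D, ∀ φ ∈ Ioo 0 π, |deriv (curveρ p r) φ| ≤ D := by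
  have hpi : (0 : ℝ) < π / 2 := by positivity
  obtain ⟨B, hB⟩ := isCompact_Icc.exists_bound_of_continuousOn
    (hp.continuousOn_derivWithin (uniqueDiffOn_Icc hpi) le_rfl)
  have hB0 : 0 ≤ B := (norm_nonneg _).trans (hB 0 ⟨le_rfl, hpi.le⟩)
  refine ⟨max B |deriv (curveρ p r) (π / 2)|, fun φ hφ => ?_⟩
  have hsin := sin_pos_of_mem_Ioo hφ
  have hs := mul_sin_mem_Icc hr (Ioo_subset_Icc_self hφ)
  rcases hr.1.eq_or_lt with rfl | hr0
  · have : curveρ p 0 = fun _ => p (arcsin 0) := by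
      funext φ
      simp [curveρ]
    rw [this, deriv_const, abs_zero]
    exact le_max_of_le_left hB0
  rcases hs.2.eq_or_lt with h1 | h1
  · have : sin φ = 1 := le_antisymm (sin_le_one φ) (by nlinarith [hr.2])
    have hcos : cos φ = cos (π / 2) := by
      rw [cos_pi_div_two, ← sq_eq_zero_iff]
      nlinarith [sin_sq_add_cos_sq φ]
    rw [injOn_cos (Ioo_subset_Icc_self hφ) ⟨hpi.le, by linarith⟩ hcos]
    exact le_max_right _ _
  · have h0 : 0 < r * sin φ := mul_pos hr0 hsin
    have hmem : arcsin (r * sin φ) ∈ Ioo 0 (π / 2) := ⟨arcsin_pos.2 h0, arcsin_lt_pi_div_two.2 h1⟩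
    have hdp : HasDerivAt p (derivWithin p (Icc 0 (π / 2)) (arcsin (r * sin φ)))
        (arcsin (r * sin φ)) :=
      ((hp.differentiableOn one_ne_zero _ (Ioo_subset_Icc_self hmem)).hasDerivWithinAt).hasDerivAt
        (Icc_mem_nhds hmem.1 hmem.2)
    have hd := hdp.comp φ ((hasDerivAt_arcsin (by linarith) h1.ne).comp φ
      ((hasDerivAt_sin φ).const_mul r))
    have hder : deriv (curveρ p r) φ = _ := hd.deriv
    rw [hder, abs_mul]
    refine le_max_of_le_left ((mul_le_mul (hB _ (Ioo_subset_Icc_self hmem)) ?_ (abs_nonneg _)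
      hB0).trans_eq (mul_one B))
    have hpos : 0 < √(1 - (r * sin φ) ^ 2) := sqrt_pos.2 (by nlinarith)
    rw [one_div_mul_eq_div, abs_div, abs_of_pos hpos, div_le_one hpos]
    refine abs_le_sqrt ?_
    have hr2 : r ^ 2 ≤ 1 := pow_le_one₀ hr.1 hr.2
    linear_combination hr2 + r ^ 2 * sin_sq_add_cos_sq φ

theorem ContinuousOn.measurable_indicator_Icc {a b : ℝ} {g : ℝ → ℝ}
    (hg : ContinuousOn g (Icc a b)) : Measurable ((Icc a b).indicator g) := by
  classical
  rw [← piecewise_eq_indicator]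
  exact hg.measurable_piecewise continuousOn_const measurableSet_Icc

theorem ContinuousOn.exists_bound_indicator_Icc {a b : ℝ} {g : ℝ → ℝ}
    (hg : ContinuousOn g (Icc a b)) : ∃ C, ∀ x, |(Icc a b).indicator g x| ≤ C := by
  obtain ⟨C, hC⟩ := isCompact_Icc.exists_bound_of_continuousOn hg
  refine ⟨max C 0, fun x => ?_⟩
  by_cases h : x ∈ Icc a b
  · rw [indicator_of_mem h]
    exact le_max_of_le_left (hC x h)
  · rw [indicator_of_notMem h, abs_zero]
    exact le_max_right _ _

/-- The weight of the spindle transform agrees on `(0,π)` with a bounded measurable function. -/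
theorem exists_bounded_measurable_weight {v : ℝ → ℝ} (hv : ContinuousOn v (Icc 0 π))
    (hp : ContDiffOn ℝ 1 p (Icc 0 (π / 2))) (hr : r ∈ Icc (0 : ℝ) 1) :
    ∃ K : ℝ → ℝ, Measurable K ∧ (∃ C, ∀ φ, |K φ| ≤ C) ∧ ∀ φ ∈ Ioo 0 π, K φ =
      v φ * curveρ p r φ * √((curveρ p r φ) ^ 2 + (deriv (curveρ p r) φ) ^ 2) := by
  have hc := continuousOn_curveρ hp hr
  obtain ⟨A, hA⟩ := hv.exists_bound_indicator_Icc
  obtain ⟨B, hB⟩ := hc.exists_bound_indicator_Icc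
  obtain ⟨D, hD⟩ := exists_bound_deriv_curveρ hp hr
  have hD0 : 0 ≤ D := (abs_nonneg _).trans (hD (π / 2) ⟨by positivity, by linarith [pi_pos]⟩)
  have hD' (φ : ℝ) : |(Ioo 0 π).indicator (deriv (curveρ p r)) φ| ≤ D := by
    by_cases h : φ ∈ Ioo 0 π
    · rw [indicator_of_mem h]
      exact hD φ h
    · rwa [indicator_of_notMem h, abs_zero]
  refine ⟨fun φ => (Icc 0 π).indicator v φ * (Icc 0 π).indicator (curveρ p r) φ *
    √((Icc 0 π).indicator (curveρ p r) φ ^ 2 + (Ioo 0 π).indicator (deriv (curveρ p r)) φ ^ 2),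
    ?_, ⟨A * B * √(B ^ 2 + D ^ 2), fun φ => ?_⟩, fun φ hφ => ?_⟩
  · exact (hv.measurable_indicator_Icc.mul hc.measurable_indicator_Icc).mul
      ((hc.measurable_indicator_Icc.pow_const 2).add
        (((measurable_deriv _).indicator measurableSet_Ioo).pow_const 2)).sqrt
  · have hA0 : 0 ≤ A := (abs_nonneg _).trans (hA φ)
    have hB0 : 0 ≤ B := (abs_nonneg _).trans (hB φ)
    rw [abs_mul, abs_mul, abs_of_nonneg (sqrt_nonneg _)]
    refine mul_le_mul (mul_le_mul (hA φ) (hB φ) (abs_nonneg _) hA0) (sqrt_le_sqrt (add_le_add ?_ ?_))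
      (sqrt_nonneg _) (mul_nonneg hA0 hB0)
    · exact sq_le_sq' (abs_le.1 (hB φ)).1 (abs_le.1 (hB φ)).2
    · exact sq_le_sq' (abs_le.1 (hD' φ)).1 (abs_le.1 (hD' φ)).2
  · simp only [indicator_of_mem hφ, indicator_of_mem (Ioo_subset_Icc_self hφ)]

end Curve

theorem intervalIntegral_colatitude_congr {g₁ g₂ : ℝ → ℂ} (h : ∀ φ ∈ Ioo 0 π, g₁ φ = g₂ φ) :
    ∫ φ in (0 : ℝ)..π, g₁ φ = ∫ φ in (0 : ℝ)..π, g₂ φ := by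
  simp only [intervalIntegral.integral_of_le pi_pos.le, integral_Ioc_eq_integral_Ioo]
  exact setIntegral_congr_fun measurableSet_Ioo h

theorem harmCoef_eq_integral_sphereMeasure {f : R3 → ℝ} (hf : Continuous f) {l : ℕ} {m : ℤ}
    {c : ℂ} (hc : ∀ θ, ∀ φ ∈ Icc 0 π,
      (starRingEnd ℂ) (sphHarm l m θ φ) = c * solidHarm l m (sphVec θ φ)) (R : ℝ) :
    harmCoef f l m R = c * ∫ x, (f (R • x) : ℂ) * solidHarm l m x ∂sphereMeasure := by
  have hcont : Continuous fun x : R3 => (f (R • x) : ℂ) * solidHarm l m x :=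
    (Complex.continuous_ofReal.comp (hf.comp (continuous_const_smul R))).mul
      (continuous_solidHarm l m)
  rw [integral_sphereMeasure_symm (integrable_sphereMeasure hcont), integral_colatitudeMeasure,
    harmCoef, ← intervalIntegral.integral_const_mul]
  refine intervalIntegral_colatitude_congr fun φ hφ => ?_
  simp only [hc _ φ (Ioo_subset_Icc_self hφ), integral_azimuthMeasure, Complex.real_smul,
    ← intervalIntegral.integral_const_mul]
  refine intervalIntegral.integral_congr fun θ _ => ?_
  ring

theorem genSpindleCoef_eq_integral_sphereMeasure {w : ℝ → ℝ → ℝ} {p K R : ℝ → ℝ} {f : R3 → ℝ}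
    {r C M : ℝ} (hK : Measurable K) (hR : Measurable R) (hf : Continuous f)
    (hC : ∀ φ, |K φ| ≤ C) (hM : ∀ x, |f x| ≤ M) (hRp : ∀ φ ∈ Ioo 0 π, R φ = curveρ p r φ)
    (hKw : ∀ φ ∈ Ioo 0 π, K φ = w r φ * curveρ p r φ *
      √((curveρ p r φ) ^ 2 + (deriv (curveρ p r) φ) ^ 2)) {l : ℕ} {m : ℤ}
    {c : ℂ} (hc : ∀ θ, ∀ φ ∈ Icc 0 π,
      (starRingEnd ℂ) (sphHarm l m θ φ) = c * solidHarm l m (sphVec θ φ)) :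
    genSpindleCoef w p f l m r = c * ∫ y, ((∫ x, zonalKernel K R f x y ∂sphereMeasure : ℝ) : ℂ) *
      solidHarm l m y ∂sphereMeasure := by
  have hS (α β : ℝ) : genSpindle w p f r α β =
      ∫ x, zonalKernel K R f x (sphVec α β) ∂sphereMeasure := by
    rw [integral_zonalKernel hK hR hf hC hM, genSpindle]
    refine intervalIntegral.integral_congr fun θ _ => ?_
    simp only [intervalIntegral.integral_of_le pi_pos.le, integral_Ioc_eq_integral_Ioo]
    refine setIntegral_congr_fun measurableSet_Ioo fun φ hφ => ?_
    simp only [hRp φ hφ, hKw φ hφ]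
    ring
  have hint : Integrable (fun y => ((∫ x, zonalKernel K R f x y ∂sphereMeasure : ℝ) : ℂ) *
      solidHarm l m y) sphereMeasure := by
    have := (integrable_zonalKernel_mul hK hR hf hC hM
      (continuous_solidHarm l m)).integral_prod_right
    simpa only [integral_mul_const, integral_complex_ofReal] using this
  rw [integral_sphereMeasure_symm hint, integral_colatitudeMeasure, genSpindleCoef,
    ← intervalIntegral.integral_const_mul]
  refine intervalIntegral_colatitude_congr fun β hβ => ?_
  simp only [hc _ β (Ioo_subset_Icc_self hβ), integral_azimuthMeasure, Complex.real_smul,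
    ← intervalIntegral.integral_const_mul, hS]
  refine intervalIntegral.integral_congr fun α _ => ?_
  ring

/-- Lemma 1 of the paper: the `(l,m)` harmonic coefficient of the
generalized spindle transform of `f` is `2π` times a one-dimensional weighted integral
of the harmonic coefficient `F_{lm}` against the Legendre polynomial `P_l`. -/
theorem spindle_harmonic_decomposition
    (f : R3 → ℝ) (hf : ContDiff ℝ (⊤ : ℕ∞) f) (hfc : HasCompactSupport f)
    (p : ℝ → ℝ) (hp : ContDiffOn ℝ 1 p (Icc 0 (π / 2)))
    (w : ℝ → ℝ → ℝ)
    (hw : ContinuousOn (fun q : ℝ × ℝ => w q.1 q.2) (Icc (0:ℝ) 1 ×ˢ Icc (0:ℝ) π))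
    (l : ℕ) (m : ℤ) (hm : m.natAbs ≤ l) (r : ℝ) (hr : r ∈ Icc (0:ℝ) 1) :
    genSpindleCoef w p f l m r =
      ((2 * π : ℝ) : ℂ) * ∫ φ in (0:ℝ)..π,
        ((w r φ * curveρ p r φ * sin φ *
            Real.sqrt ((curveρ p r φ) ^ 2 + (deriv (curveρ p r) φ) ^ 2) : ℝ) : ℂ) *
          harmCoef f l m (curveρ p r φ) * ((legendreP l (cos φ) : ℝ) : ℂ) := by
  obtain ⟨c, hc⟩ := conj_sphHarm l m
  obtain ⟨M, hM⟩ := hfc.exists_bound_of_continuous hf.continuous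
  have hv : ContinuousOn (w r) (Icc 0 π) :=
    hw.comp (f := fun φ : ℝ => (r, φ)) (by fun_prop) fun φ hφ => ⟨hr, hφ⟩
  obtain ⟨K, hK, ⟨C, hC⟩, hKw⟩ := exists_bounded_measurable_weight hv hp hr
  have hR : Measurable ((Icc 0 π).indicator (curveρ p r)) :=
    (continuousOn_curveρ hp hr).measurable_indicator_Icc
  have hRp (φ : ℝ) (hφ : φ ∈ Ioo 0 π) : (Icc 0 π).indicator (curveρ p r) φ = curveρ p r φ :=
    indicator_of_mem (Ioo_subset_Icc_self hφ) _
  rw [genSpindleCoef_eq_integral_sphereMeasure hK hR hf.continuous hC hM hRp hKw hc,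
    integral_integral_zonalKernel_mul_solidHarm hK hR hf.continuous hC hM,
    integral_colatitudeMeasure, ← intervalIntegral.integral_const_mul,
    ← intervalIntegral.integral_const_mul]
  refine intervalIntegral_colatitude_congr fun φ hφ => ?_
  rw [harmCoef_eq_integral_sphereMeasure hf.continuous hc, hRp φ hφ, hKw φ hφ, Complex.real_smul]
  push_cast
  ring
end
end

section
/- Let f be a smooth compactly supported function on ℝ³ with polar form F, let p ∈ C¹([0,π/2]), set ρ(r,φ) = p(arcsin(r sin φ)), and let w : [0,1]×[0,π] → ℝ be continuous and satisfy w(r, π−φ) = w(r,φ) for all r ∈ [0,1] and φ ∈ [0,π]. Then for every odd natural number l, every integer m with |m| ≤ l, and every r ∈ [0,1], the harmonic coefficient 𝒮_{w,p}f_{lm}(r) = ∫₀^π ∫₀^{2π} 𝒮_{w,p}f(r,α,β) conj(Y_l^m(α,β)) sin β dα dβ vanishes. -/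
noncomputable section
open Real MeasureTheory Set Filter

lemma legendreP_neg (l : ℕ) (x : ℝ) : legendreP l (-x) = (-1) ^ l * legendreP l x := by
  unfold legendreP
  rw [mul_left_comm]
  congr 1
  rw [← Finset.sum_range_reflect, Finset.mul_sum]
  refine Finset.sum_congr rfl fun k hk => ?_
  have hkl : k ≤ l := Nat.lt_succ_iff.mp (Finset.mem_range.mp hk)
  rw [show l + 1 - 1 - k = l - k by omega, Nat.choose_symm hkl, Nat.sub_sub_self hkl,
    show -x - 1 = (-1) * (x + 1) by ring, show -x + 1 = (-1) * (x - 1) by ring,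
    mul_pow, mul_pow,
    show (-1 : ℝ) ^ l = (-1) ^ (l - k) * (-1) ^ k by rw [← pow_add, Nat.sub_add_cancel hkl]]
  ring

lemma assocP_neg (l m : ℕ) (x : ℝ) : assocP l m (-x) = (-1) ^ (l + m) * assocP l m x := by
  have h := iteratedDeriv_comp_neg m (legendreP l) (-x)
  have hfun : (fun a => legendreP l (-a)) = fun a => (-1) ^ l * legendreP l a :=
    funext (legendreP_neg l)
  rw [hfun, iteratedDeriv_const_mul_field, neg_neg, smul_eq_mul] at h
  have hsq : ((-1 : ℝ) ^ l) * (-1) ^ l = 1 := by rw [← mul_pow]; norm_num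
  have h' : iteratedDeriv m (legendreP l) (-x)
      = (-1) ^ l * ((-1) ^ m * iteratedDeriv m (legendreP l) x) := by
    rw [← h, ← mul_assoc, hsq, one_mul]
  unfold assocP
  rw [h', neg_sq, pow_add]
  ring

lemma assocPZ_neg (l : ℕ) (m : ℤ) (x : ℝ) :
    assocPZ l m (-x) = (-1) ^ (l + m.natAbs) * assocPZ l m x := by
  unfold assocPZ
  split_ifs with h
  · rw [assocP_neg, show m.toNat = m.natAbs by omega]
  · rw [assocP_neg]
    ring

lemma exp_I_mul_int_mul_pi (m : ℤ) :
    Complex.exp (Complex.I * m * π) = (-1) ^ m.natAbs := by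
  have h : Complex.exp (Complex.I * m * π) = (-1) ^ m := by
    rw [show Complex.I * m * π = (m : ℂ) * (π * Complex.I) by ring, Complex.exp_int_mul,
      Complex.exp_pi_mul_I]
  rw [h]
  rcases Int.natAbs_eq m with h | h
  · conv_lhs => rw [h]
    rw [zpow_natCast]
  · conv_lhs => rw [h]
    rw [zpow_neg, zpow_natCast, ← inv_pow]
    norm_num

/-- Parity of spherical harmonics under the antipodal map. -/
lemma sphHarm_antipodal (l : ℕ) (m : ℤ) (θ φ : ℝ) :
    sphHarm l m (θ + π) (π - φ) = (-1) ^ l * sphHarm l m θ φ := by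
  have hsq : ((-1 : ℂ) ^ m.natAbs) * (-1) ^ m.natAbs = 1 := by rw [← mul_pow]; norm_num
  unfold sphHarm
  rw [cos_pi_sub, assocPZ_neg, Complex.ofReal_add, mul_add, Complex.exp_add,
    exp_I_mul_int_mul_pi, pow_add]
  push_cast
  linear_combination (-1) ^ l * ((-1 : ℂ) ^ m *
    (Real.sqrt ((2 * (l : ℝ) + 1) * (((l : ℤ) - m).toNat.factorial : ℝ) /
      (4 * π * (((l : ℤ) + m).toNat.factorial : ℝ))) : ℂ) *
    assocPZ l m (cos φ)) * Complex.exp (Complex.I * m * θ) * hsq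

lemma sphHarm_periodic (l : ℕ) (m : ℤ) (φ : ℝ) :
    Function.Periodic (fun θ => sphHarm l m θ φ) (2 * π) := by
  intro θ
  have h1 := sphHarm_antipodal l m (θ + π) (π - φ)
  have h2 := sphHarm_antipodal l m θ φ
  have hsq : ((-1 : ℂ) ^ l) * (-1) ^ l = 1 := by rw [← mul_pow]; norm_num
  rw [sub_sub_cancel, h2, ← mul_assoc, hsq, one_mul, add_assoc, ← two_mul] at h1
  exact h1

lemma rotUV_antipodal (α β θ φ : ℝ) :
    rotUV (α + π) (π - β) (sphVec θ φ) = rotUV α β (sphVec (-θ) (π - φ)) := by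
  ext i
  fin_cases i <;>
    simp [rotUV, rotZ, rotY, sphVec, cos_pi_sub, sin_pi_sub, cos_add_pi, sin_add_pi] <;> ring

lemma sphVec_add_two_pi (θ φ : ℝ) : sphVec (θ + 2 * π) φ = sphVec θ φ := by
  simp [sphVec]

lemma rotUV_add_two_pi (α β : ℝ) (x : R3) : rotUV (α + 2 * π) β x = rotUV α β x := by
  simp [rotUV, rotZ]

lemma curveρ_pi_sub (p : ℝ → ℝ) (r φ : ℝ) : curveρ p r (π - φ) = curveρ p r φ := by
  simp [curveρ]

lemma deriv_curveρ_pi_sub (p : ℝ → ℝ) (r φ : ℝ) :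
    deriv (curveρ p r) (π - φ) = -deriv (curveρ p r) φ := by
  have h := deriv_comp_const_sub (f := curveρ p r) π φ
  rw [funext (curveρ_pi_sub p r)] at h
  rw [← neg_eq_iff_eq_neg, ← h]

lemma genSpindle_add_two_pi (w : ℝ → ℝ → ℝ) (p : ℝ → ℝ) (f : R3 → ℝ) (r α β : ℝ) :
    genSpindle w p f r (α + 2 * π) β = genSpindle w p f r α β := by
  simp only [genSpindle, rotUV_add_two_pi]

/-- For a weight symmetric about the equator, the generalized spindle transform is even. -/
lemma genSpindle_antipodal (w : ℝ → ℝ → ℝ) (p : ℝ → ℝ) (f : R3 → ℝ) {r : ℝ}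
    (hw : ∀ φ ∈ Icc (0:ℝ) π, w r (π - φ) = w r φ) (α β : ℝ) :
    genSpindle w p f r (α + π) (π - β) = genSpindle w p f r α β := by
  unfold genSpindle
  set g : ℝ → ℝ := fun θ => ∫ φ in (0:ℝ)..π,
    w r φ * curveρ p r φ * sin φ *
      Real.sqrt ((curveρ p r φ) ^ 2 + (deriv (curveρ p r) φ) ^ 2) *
      f (curveρ p r φ • rotUV α β (sphVec θ φ)) with hg
  have hper : Function.Periodic g (2 * π) := fun θ => by
    simp only [hg, sphVec_add_two_pi]
  have hinner : ∀ θ : ℝ, (∫ φ in (0:ℝ)..π, w r φ * curveρ p r φ * sin φ *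
      Real.sqrt ((curveρ p r φ) ^ 2 + (deriv (curveρ p r) φ) ^ 2) *
      f (curveρ p r φ • rotUV (α + π) (π - β) (sphVec θ φ))) = g (-θ) := by
    intro θ
    have hsub := intervalIntegral.integral_comp_sub_left (a := 0) (b := π)
      (fun φ => w r φ * curveρ p r φ * sin φ *
        Real.sqrt ((curveρ p r φ) ^ 2 + (deriv (curveρ p r) φ) ^ 2) *
        f (curveρ p r φ • rotUV α β (sphVec (-θ) φ))) π
    rw [sub_self, sub_zero] at hsub
    refine Eq.trans ?_ hsub
    refine intervalIntegral.integral_congr fun φ hφ => ?_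
    rw [uIcc_of_le pi_pos.le] at hφ
    simp only [curveρ_pi_sub, deriv_curveρ_pi_sub, hw φ hφ, sin_pi_sub, neg_sq, rotUV_antipodal]
  simp only [hinner]
  rw [intervalIntegral.integral_comp_neg, neg_zero]
  have := hper.intervalIntegral_add_eq (-(2 * π)) 0
  rwa [neg_add_cancel, zero_add] at this

/-- Integrating an antipodally odd function over the sphere gives zero. -/
lemma integral_sphere_eq_zero_of_antipodal_odd {g : ℝ → ℝ → ℂ}
    (hper : ∀ β, Function.Periodic (fun α => g α β) (2 * π))
    (hodd : ∀ α β, g (α + π) (π - β) = -g α β) :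
    ∫ β in (0:ℝ)..π, ∫ α in (0:ℝ)..(2 * π), g α β = 0 := by
  have hinner : ∀ β : ℝ, (∫ α in (0:ℝ)..(2 * π), g α (π - β))
      = -∫ α in (0:ℝ)..(2 * π), g α β := by
    intro β
    have h1 := (hper (π - β)).intervalIntegral_add_eq 0 π
    rw [zero_add] at h1
    have h2 := intervalIntegral.integral_comp_add_right (a := 0) (b := 2 * π)
      (fun α => g α (π - β)) π
    rw [zero_add, add_comm (2 * π) π] at h2
    rw [h1, ← h2, ← intervalIntegral.integral_neg]
    simp only [hodd]
  have h := intervalIntegral.integral_comp_sub_left (a := 0) (b := π)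
    (fun β => ∫ α in (0:ℝ)..(2 * π), g α β) π
  simp only [sub_self, sub_zero, hinner, intervalIntegral.integral_neg] at h
  exact self_eq_neg.mp h.symm

/-- if the weight is symmetric about `φ = π/2`, then the odd-degree
harmonic coefficients of the generalized spindle transform vanish. -/
theorem genSpindleCoef_odd_vanish
    (f : R3 → ℝ) (hf : ContDiff ℝ (⊤ : ℕ∞) f) (hfc : HasCompactSupport f)
    (p : ℝ → ℝ) (hp : ContDiffOn ℝ 1 p (Icc 0 (π / 2)))
    (w : ℝ → ℝ → ℝ)
    (hw : ContinuousOn (fun q : ℝ × ℝ => w q.1 q.2) (Icc (0:ℝ) 1 ×ˢ Icc (0:ℝ) π))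
    (hwsym : ∀ r ∈ Icc (0:ℝ) 1, ∀ φ ∈ Icc (0:ℝ) π, w r (π - φ) = w r φ)
    (l : ℕ) (hl : Odd l) (m : ℤ) (hm : m.natAbs ≤ l) (r : ℝ) (hr : r ∈ Icc (0:ℝ) 1) :
    genSpindleCoef w p f l m r = 0 := by
  refine integral_sphere_eq_zero_of_antipodal_odd (fun β α => ?_) fun α β => ?_
  · have h := sphHarm_periodic l m β α
    simp only at h
    simp only [genSpindle_add_two_pi, h]
  · simp only [genSpindle_antipodal w p f (hwsym r hr), sphHarm_antipodal, sin_pi_sub,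
      hl.neg_one_pow, neg_one_mul, map_neg]
    ring
end
end

section
/- Let a > 0, let K : {(r,ρ) ∈ ℝ² : 0 ≤ ρ ≤ r ≤ a} → ℝ be continuous and let F : [0,a] → ℝ be continuous. Then for every z ∈ [0,a], ∫₀^z (z−r)^{−1/2} (∫₀^r F(ρ) K(r,ρ) (r−ρ)^{−1/2} dρ) dr = ∫₀^z F(ρ) Q(z,ρ) dρ, where Q(z,ρ) = ∫₀^1 K(ρ + (z−ρ)t, ρ) t^{−1/2} (1−t)^{−1/2} dt. Moreover Q(z,z) = π K(z,z) for all z ∈ [0,a]. -/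
noncomputable section
open Real MeasureTheory Set

lemma hasDerivAt_arcsin_two_mul_sub_one {t : ℝ} (ht : t ∈ Ioo (0 : ℝ) 1) :
    HasDerivAt (fun s : ℝ => arcsin (2 * s - 1)) (1 / (√t * √(1 - t))) t := by
  have h0 : 0 < t := ht.1
  have h1 : 0 < 1 - t := sub_pos.2 ht.2
  have hlin : HasDerivAt (fun s : ℝ => 2 * s - 1) 2 t := by
    simpa using ((hasDerivAt_id t).const_mul 2).sub_const 1
  have h := (hasDerivAt_arcsin (x := 2 * t - 1) (by linarith) (by linarith)).comp t hlin
  refine h.congr_deriv ?_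
  have hs : √(1 - (2 * t - 1) ^ 2) = 2 * (√t * √(1 - t)) := by
    rw [show 1 - (2 * t - 1) ^ 2 = 2 ^ 2 * (t * (1 - t)) by ring, sqrt_mul (by norm_num),
      sqrt_sq (by norm_num), sqrt_mul h0.le]
  have := sqrt_pos.2 h0
  have := sqrt_pos.2 h1
  rw [hs]
  field_simp

lemma integral_one_div_sqrt_mul_sqrt_one_sub :
    ∫ t in (0 : ℝ)..1, 1 / (√t * √(1 - t)) = π := by
  have hcont : ContinuousOn (fun s : ℝ => arcsin (2 * s - 1)) (Icc 0 1) := by fun_prop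
  have hint := intervalIntegral.integrableOn_deriv_of_nonneg hcont
    (fun t ht => hasDerivAt_arcsin_two_mul_sub_one ht) (fun t _ => by positivity)
  rw [intervalIntegral.integral_eq_sub_of_hasDerivAt_of_le zero_le_one hcont
    (fun t ht => hasDerivAt_arcsin_two_mul_sub_one ht)
    ((intervalIntegrable_iff_integrableOn_Ioc_of_le zero_le_one).2 hint)]
  norm_num

lemma integrable_indicator_one_div_sqrt (z : ℝ) :
    Integrable ((Ioo 0 z).indicator fun x : ℝ => 1 / √x) := by
  rw [integrable_indicator_iff measurableSet_Ioo]
  rcases le_or_gt z 0 with hz | hz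
  · simp [Ioo_eq_empty_of_le hz]
  have h := (intervalIntegrable_iff_integrableOn_Ioo_of_le hz.le).1
    (intervalIntegral.intervalIntegrable_rpow' (a := 0) (b := z) (r := -(1 / 2)) (by norm_num))
  refine h.congr_fun (fun x hx => ?_) measurableSet_Ioo
  simp only [rpow_neg hx.1.le, sqrt_eq_rpow, one_div]

lemma integrable_abel_kernel (z : ℝ) :
    Integrable (fun q : ℝ × ℝ => (Ioo 0 z).indicator (fun x : ℝ => 1 / √x) (z - q.1) *
      (Ioo 0 z).indicator (fun x : ℝ => 1 / √x) (q.1 - q.2)) := by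
  have hp := integrable_indicator_one_div_sqrt z
  have h := (hp.comp_sub_left z).convolution_integrand (ContinuousLinearMap.mul ℝ ℝ) hp.comp_neg
  rw [Measure.volume_eq_prod]
  simpa [Function.comp_def] using h.swap

lemma isOpen_triangle (z : ℝ) : IsOpen {q : ℝ × ℝ | 0 < q.2 ∧ q.2 < q.1 ∧ q.1 < z} :=
  (isOpen_lt continuous_const continuous_snd).inter
    ((isOpen_lt continuous_snd continuous_fst).inter (isOpen_lt continuous_fst continuous_const))

lemma isCompact_triangle (a : ℝ) :
    IsCompact {q : ℝ × ℝ | 0 ≤ q.2 ∧ q.2 ≤ q.1 ∧ q.1 ≤ a} := by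
  refine (isCompact_Icc.prod isCompact_Icc : IsCompact (Icc 0 a ×ˢ Icc 0 a)).of_isClosed_subset
    ((isClosed_le continuous_const continuous_snd).inter
      ((isClosed_le continuous_snd continuous_fst).inter
        (isClosed_le continuous_fst continuous_const))) ?_
  rintro ⟨r, ρ⟩ ⟨h1, h2, h3⟩
  exact ⟨⟨h1.trans h2, h3⟩, ⟨h1, h2.trans h3⟩⟩

/-- The product of a function continuous on the closed triangle with the Abel kernel is
integrable over the triangle. -/
lemma integrable_indicator_triangle {z : ℝ} {H : ℝ × ℝ → ℝ}
    (hH : ContinuousOn H {q : ℝ × ℝ | 0 ≤ q.2 ∧ q.2 ≤ q.1 ∧ q.1 ≤ z}) :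
    Integrable ({q : ℝ × ℝ | 0 < q.2 ∧ q.2 < q.1 ∧ q.1 < z}.indicator
      fun q => H q / (√(z - q.1) * √(q.1 - q.2))) := by
  obtain ⟨M, hM⟩ := (isCompact_triangle z).exists_bound_of_continuousOn hH
  have hsub : {q : ℝ × ℝ | 0 < q.2 ∧ q.2 < q.1 ∧ q.1 < z} ⊆
      {q : ℝ × ℝ | 0 ≤ q.2 ∧ q.2 ≤ q.1 ∧ q.1 ≤ z} :=
    fun q hq => ⟨hq.1.le, hq.2.1.le, hq.2.2.le⟩
  have hmeas := (isOpen_triangle z).measurableSet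
  refine ((integrable_abel_kernel z).const_mul |M|).mono' ?_ (ae_of_all _ fun q => ?_)
  · rw [aestronglyMeasurable_indicator_iff hmeas]
    refine ContinuousOn.aestronglyMeasurable ?_ hmeas
    refine (hH.mono hsub).div (by fun_prop) fun q hq => ?_
    exact mul_ne_zero (sqrt_pos.2 (sub_pos.2 hq.2.2)).ne' (sqrt_pos.2 (sub_pos.2 hq.2.1)).ne'
  · by_cases hq : q ∈ {q : ℝ × ℝ | 0 < q.2 ∧ q.2 < q.1 ∧ q.1 < z}
    · obtain ⟨h1, h2, h3⟩ := id hq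
      have hm1 : z - q.1 ∈ Ioo 0 z := ⟨by linarith, by linarith⟩
      have hm2 : q.1 - q.2 ∈ Ioo 0 z := ⟨by linarith, by linarith⟩
      rw [indicator_of_mem hq, indicator_of_mem hm1, indicator_of_mem hm2, norm_div,
        norm_of_nonneg (by positivity : 0 ≤ √(z - q.1) * √(q.1 - q.2)), div_mul_div_comm, one_mul,
        mul_one_div]
      gcongr
      exact (hM q (hsub hq)).trans (le_abs_self M)
    · rw [indicator_of_notMem hq, norm_zero]
      refine mul_nonneg (abs_nonneg M) (mul_nonneg ?_ ?_) <;>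
        exact indicator_nonneg (fun x _ => by positivity) _

/-- The substitution `r = ρ + (z - ρ) * t` in an Abel integral. -/
lemma integral_div_sqrt_mul_sqrt (f : ℝ → ℝ) {ρ z : ℝ} (h : ρ < z) :
    ∫ r in ρ..z, f r / (√(z - r) * √(r - ρ)) =
      ∫ t in (0 : ℝ)..1, f (ρ + (z - ρ) * t) / (√t * √(1 - t)) := by
  have hpos : 0 < z - ρ := sub_pos.2 h
  have hsub := intervalIntegral.mul_integral_comp_add_mul (a := 0) (b := 1)
    (f := fun r => f r / (√(z - r) * √(r - ρ))) (c := z - ρ) (d := ρ)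
  simp only [mul_zero, add_zero, mul_one, add_sub_cancel] at hsub
  rw [← hsub, ← intervalIntegral.integral_const_mul]
  refine intervalIntegral.integral_congr fun t _ => ?_
  have hs : √(z - ρ) * √(z - ρ) = z - ρ := mul_self_sqrt hpos.le
  rw [show z - (ρ + (z - ρ) * t) = (z - ρ) * (1 - t) by ring,
    show ρ + (z - ρ) * t - ρ = (z - ρ) * t by ring, sqrt_mul hpos.le, sqrt_mul hpos.le,
    show √(z - ρ) * √(1 - t) * (√(z - ρ) * √t) = (√(z - ρ) * √(z - ρ)) * (√t * √(1 - t)) by ring,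
    hs, mul_div_assoc', mul_div_mul_left _ _ hpos.ne']

/-- Interchange of the order of integration for the Abel kernel over a triangle. -/
lemma integral_integral_triangle_swap {z : ℝ} (hz : 0 ≤ z) {H : ℝ × ℝ → ℝ}
    (hH : ContinuousOn H {q : ℝ × ℝ | 0 ≤ q.2 ∧ q.2 ≤ q.1 ∧ q.1 ≤ z}) :
    ∫ r in (0 : ℝ)..z, ∫ ρ in (0 : ℝ)..r, H (r, ρ) / (√(z - r) * √(r - ρ)) =
      ∫ ρ in (0 : ℝ)..z, ∫ r in ρ..z, H (r, ρ) / (√(z - r) * √(r - ρ)) := by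
  set G : ℝ → ℝ → ℝ := fun r ρ => {q : ℝ × ℝ | 0 < q.2 ∧ q.2 < q.1 ∧ q.1 < z}.indicator
    (fun q => H q / (√(z - q.1) * √(q.1 - q.2))) (r, ρ) with hG
  have hswap : ∫ r, ∫ ρ, G r ρ = ∫ ρ, ∫ r, G r ρ :=
    integral_integral_swap (integrable_indicator_triangle hH)
  have hleft : (fun r => ∫ ρ, G r ρ) = (Ioo 0 z).indicator
      fun r => ∫ ρ in (0 : ℝ)..r, H (r, ρ) / (√(z - r) * √(r - ρ)) := by
    funext r
    by_cases hr : r ∈ Ioo 0 z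
    · rw [indicator_of_mem hr, intervalIntegral.integral_of_le hr.1.le, integral_Ioc_eq_integral_Ioo,
        ← integral_indicator measurableSet_Ioo]
      refine integral_congr_ae (ae_of_all _ fun ρ => ?_)
      simp only [hG, indicator_apply, mem_ofPred_eq, mem_Ioo, hr.2, and_true]
    · rw [indicator_of_notMem hr]
      refine (integral_congr_ae (ae_of_all _ fun ρ => ?_)).trans (integral_zero _ _)
      exact indicator_of_notMem (fun h => hr ⟨h.1.trans h.2.1, h.2.2⟩) _
  have hright : (fun ρ => ∫ r, G r ρ) = (Ioo 0 z).indicator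
      fun ρ => ∫ r in ρ..z, H (r, ρ) / (√(z - r) * √(r - ρ)) := by
    funext ρ
    by_cases hρ : ρ ∈ Ioo 0 z
    · rw [indicator_of_mem hρ, intervalIntegral.integral_of_le hρ.2.le, integral_Ioc_eq_integral_Ioo,
        ← integral_indicator measurableSet_Ioo]
      refine integral_congr_ae (ae_of_all _ fun r => ?_)
      simp only [hG, indicator_apply, mem_ofPred_eq, mem_Ioo, hρ.1, true_and]
    · rw [indicator_of_notMem hρ]
      refine (integral_congr_ae (ae_of_all _ fun r => ?_)).trans (integral_zero _ _)
      exact indicator_of_notMem (fun h => hρ ⟨h.1, h.2.1.trans h.2.2⟩) _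
  rwa [hleft, hright, integral_indicator measurableSet_Ioo, integral_indicator measurableSet_Ioo,
    ← integral_Ioc_eq_integral_Ioo, ← integral_Ioc_eq_integral_Ioo,
    ← intervalIntegral.integral_of_le hz, ← intervalIntegral.integral_of_le hz] at hswap

/-- applying the Abel-type averaging `∫₀^z (z-r)^{-1/2} ⋅ dr` to a weakly
singular Volterra operator, interchanging the integration order and substituting
`r = ρ + (z-ρ)t`, yields the kernel `Q(z,ρ) = ∫₀^1 K(ρ+(z-ρ)t,ρ) t^{-1/2}(1-t)^{-1/2} dt`,
which satisfies `Q(z,z) = π K(z,z)`. -/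
theorem abel_average_volterra
    (a : ℝ) (ha : 0 < a) (K : ℝ → ℝ → ℝ) (F : ℝ → ℝ)
    (hK : ContinuousOn (fun q : ℝ × ℝ => K q.1 q.2)
      {q : ℝ × ℝ | 0 ≤ q.2 ∧ q.2 ≤ q.1 ∧ q.1 ≤ a})
    (hF : ContinuousOn F (Icc 0 a))
    (Q : ℝ → ℝ → ℝ)
    (hQ : ∀ z ρ : ℝ, Q z ρ =
      ∫ t in (0:ℝ)..1, K (ρ + (z - ρ) * t) ρ / (Real.sqrt t * Real.sqrt (1 - t))) :
    (∀ z ∈ Icc (0:ℝ) a,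
      (∫ r in (0:ℝ)..z, (1 / Real.sqrt (z - r)) *
          ∫ ρ in (0:ℝ)..r, F ρ * K r ρ / Real.sqrt (r - ρ)) =
        ∫ ρ in (0:ℝ)..z, F ρ * Q z ρ) ∧
    (∀ z ∈ Icc (0:ℝ) a, Q z z = π * K z z) := by
  refine ⟨fun z hz => ?_, fun z _ => ?_⟩
  · have hH : ContinuousOn (fun q : ℝ × ℝ => F q.2 * K q.1 q.2)
        {q : ℝ × ℝ | 0 ≤ q.2 ∧ q.2 ≤ q.1 ∧ q.1 ≤ z} :=
      (hF.comp continuousOn_snd fun q hq => ⟨hq.1, (hq.2.1.trans hq.2.2).trans hz.2⟩).mul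
        (hK.mono fun q hq => ⟨hq.1, hq.2.1, hq.2.2.trans hz.2⟩)
    calc
      _ = ∫ r in (0 : ℝ)..z, ∫ ρ in (0 : ℝ)..r, F ρ * K r ρ / (√(z - r) * √(r - ρ)) := by
        refine intervalIntegral.integral_congr fun r _ => ?_
        rw [← intervalIntegral.integral_const_mul]
        simp only [div_mul_div_comm, one_mul]
      _ = ∫ ρ in (0 : ℝ)..z, ∫ r in ρ..z, F ρ * K r ρ / (√(z - r) * √(r - ρ)) :=
        integral_integral_triangle_swap hz.1 hH
      _ = ∫ ρ in (0 : ℝ)..z, F ρ * Q z ρ := by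
        simp only [intervalIntegral.integral_of_le hz.1, integral_Ioc_eq_integral_Ioo]
        refine setIntegral_congr_fun measurableSet_Ioo fun ρ hρ => ?_
        rw [integral_div_sqrt_mul_sqrt (fun r => F ρ * K r ρ) hρ.2, hQ,
          ← intervalIntegral.integral_const_mul]
        simp only [mul_div_assoc]
  · rw [hQ, mul_comm π, ← integral_one_div_sqrt_mul_sqrt_one_sub,
      ← intervalIntegral.integral_const_mul]
    simp only [sub_self, zero_mul, add_zero, mul_one_div]
end
end
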